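/- Let k ≥ 1 be an integer and let P ∈ ℝ[x₀,x₁,x₂] be a nonzero homogeneous polynomial of degree 2k, squarefree over ℂ, such that every singular point of the complex curve C = {P = 0} ⊂ ℙ²(ℂ) is a node and the total number of singular points of C in ℙ²(ℂ) equals (k−1)(2k−1) (i.e., C is a nodal rational curve of degree 2k). If ℝZ(P) is finite, then |ℝZ(P)| ≤ k² + 1. -/

import Mathlib

open MvPolynomial

/-- The real projective zero set of a homogeneous polynomial in three variables. -/
noncomputable def RZ (P : MvPolynomial (Fin 3) ℝ) : Set (Projectivization ℝ (Fin 3 → ℝ)) :=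
  {x | MvPolynomial.eval x.rep P = 0}

/-- The set of singular points of the plane curve `{Q = 0} ⊂ ℙ²(ℂ)`. -/
noncomputable def SingSet (Q : MvPolynomial (Fin 3) ℂ) :
    Set (Projectivization ℂ (Fin 3 → ℂ)) :=
  {x | ∀ i : Fin 3, MvPolynomial.eval x.rep (pderiv i Q) = 0}

/-- The point `x` is a node of the curve `{Q = 0}`. -/
noncomputable def IsNodeAt (Q : MvPolynomial (Fin 3) ℂ)
    (x : Projectivization ℂ (Fin 3 → ℂ)) : Prop :=
  (Matrix.of fun i j : Fin 3 =>
    MvPolynomial.eval x.rep (pderiv i (pderiv j Q))).rank = 2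

section

theorem herm_index {X : Type} [Fintype X] [DecidableEq X] (τ : X → X)
    (hτ : ∀ c, τ (τ c) = c) (w : X → ℂ)
    (hw : ∀ c, w (τ c) = (starRingEnd ℂ) (w c)) {W : Type} [AddCommGroup W] [Module ℂ W]
    (ev : W →ₗ[ℂ] (X → ℂ))
    (hinj : ∀ u, (∀ c, w c ≠ 0 → ev u c = 0) → u = 0)
    (hiso : ∀ u, ∑ c, w c * (ev u c * (starRingEnd ℂ) (ev u (τ c))) = 0)
    (S : Finset X) (hS2 : ∀ c, τ c ≠ c → c ∈ S ∨ τ c ∈ S) :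
    Module.finrank ℂ W ≤ (Finset.univ.filter fun c => τ c = c ∧ (w c).re < 0).card
      + (S.filter fun c => w c ≠ 0).card := by
  classical
  set A := Finset.univ.filter fun c => τ c = c ∧ (w c).re < 0 with hA
  set B := S.filter fun c => w c ≠ 0 with hB
  let Φ : W →ₗ[ℂ] ((A → ℂ) × (B → ℂ)) :=
    { toFun := fun u => (fun c => ev u c, fun c => w c * ev u c - ev u (τ c))
      map_add' := by
        intro u v
        ext c <;> simp
        ring
      map_smul' := by
        intro a u
        ext c <;> simp
        ring }
  have hΦ : Function.Injective Φ := by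
    rw [injective_iff_map_eq_zero]
    intro u hu
    have h1 : ∀ c ∈ A, ev u c = 0 := fun c hc => by
      have := congrFun (congrArg Prod.fst hu) ⟨c, hc⟩
      simpa [Φ] using this
    have h2 : ∀ c ∈ B, w c * ev u c = ev u (τ c) := fun c hc => by
      have := congrFun (congrArg Prod.snd hu) ⟨c, hc⟩
      simpa [Φ, sub_eq_zero] using this
    have hS : ∀ c ∈ S, w c * (ev u c * (starRingEnd ℂ) (ev u (τ c))) =
        if w c = 0 then 0 else (Complex.normSq (ev u (τ c)) : ℂ) := by
      intro c hc
      split_ifs with h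
      · simp [h]
      · rw [← mul_assoc, h2 c (by simp [hB, hc, h]), Complex.mul_conj]
    have hS' : ∀ c, τ c ∈ S → w c * (ev u c * (starRingEnd ℂ) (ev u (τ c))) =
        if w c = 0 then 0 else (Complex.normSq (ev u c) : ℂ) := by
      intro c hc
      have h := hS _ hc
      have e := congrArg (starRingEnd ℂ) h
      rw [hτ, hw] at e
      simp only [map_mul, Complex.conj_conj] at e
      rw [mul_comm ((starRingEnd ℂ) _)] at e
      rw [e]
      by_cases h : w c = 0 <;> simp [h]
    have hfix : ∀ c, τ c = c → w c * (ev u c * (starRingEnd ℂ) (ev u (τ c))) =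
        (((w c).re * Complex.normSq (ev u c) : ℝ) : ℂ) := by
      intro c hc
      have hr : w c = ((w c).re : ℂ) := by
        have := hw c
        rw [hc] at this
        exact (Complex.conj_eq_iff_re.mp this.symm).symm
      rw [hc, Complex.mul_conj]
      conv_lhs => rw [hr]
      push_cast
      rfl
    have hnn : ∀ c ∈ Finset.univ, 0 ≤ (w c * (ev u c * (starRingEnd ℂ) (ev u (τ c)))).re := by
      intro c _
      by_cases hc : τ c = c
      · rw [hfix c hc, Complex.ofReal_re]
        by_cases hneg : (w c).re < 0
        · rw [h1 c (by simp [hA, hc, hneg])]; simp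
        · exact mul_nonneg (not_lt.mp hneg) (Complex.normSq_nonneg _)
      · rcases hS2 c hc with h | h
        · rw [hS c h]
          split_ifs
          · simp
          · rw [Complex.ofReal_re]; exact Complex.normSq_nonneg _
        · rw [hS' c h]
          split_ifs
          · simp
          · rw [Complex.ofReal_re]; exact Complex.normSq_nonneg _
    have hsum : ∑ c, (w c * (ev u c * (starRingEnd ℂ) (ev u (τ c)))).re = 0 := by
      rw [← Complex.re_sum, hiso]; simp
    have hz := (Finset.sum_eq_zero_iff_of_nonneg hnn).mp hsum
    have key1 : ∀ c ∈ S, w c ≠ 0 → ev u (τ c) = 0 := by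
      intro c hc h
      have := hz c (Finset.mem_univ _)
      rw [hS c hc, if_neg h, Complex.ofReal_re] at this
      exact Complex.normSq_eq_zero.mp this
    apply hinj
    intro c hwc
    by_cases hc : τ c = c
    · have := hz c (Finset.mem_univ _)
      rw [hfix c hc, Complex.ofReal_re] at this
      rcases mul_eq_zero.mp this with h | h
      · exfalso
        apply hwc
        have := hw c
        rw [hc] at this
        rw [← Complex.conj_eq_iff_re.mp this.symm, h]; simp
      · exact Complex.normSq_eq_zero.mp h
    · rcases hS2 c hc with h | h
      · have e := h2 c (by simp [hB, h, hwc])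
        rw [key1 c h hwc] at e
        exact (mul_eq_zero.mp e).resolve_left hwc
      · have e := key1 _ h (by rw [hw]; simpa using hwc)
        rwa [hτ] at e
  have := LinearMap.finrank_le_finrank_of_injective hΦ
  simpa [Module.finrank_prod, Module.finrank_fintype_fun_eq_card] using this

end

section

abbrev S3 (n : ℕ) : Submodule ℂ (MvPolynomial (Fin 3) ℂ) := homogeneousSubmodule (Fin 3) ℂ n

theorem finrank_S3 (n : ℕ) : Module.finrank ℂ (S3 n) = (n + 2).choose 2 := by
  have h := homogeneousSubmodule_eq_finsupp_supported (σ := Fin 3) (R := ℂ) n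
  have hc : Nat.card {d : Fin 3 →₀ ℕ | d.degree = n} = (n + 2).choose 2 := by
    have h2 : {d : Fin 3 →₀ ℕ | d.degree = n} = ((Finset.univ : Finset (Fin 3)).finsuppAntidiag n : Set (Fin 3 →₀ ℕ)) := by
      ext d
      simp [Finset.mem_finsuppAntidiag, Finsupp.degree_eq_sum]
    rw [h2]
    simp only [Nat.card_coe_set_eq, Set.ncard_coe_finset]
    rw [Finset.card_finsuppAntidiag_nat_eq_choose]
    simp
    rw [show n + 2 = 2 + n by ring]
    rw [Nat.choose_symm_add]
  have e : (S3 n) ≃ₗ[ℂ] ({d : Fin 3 →₀ ℕ | d.degree = n} →₀ ℂ) := by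
    rw [S3, h]
    exact AddMonoidAlgebra.supportedEquivFinsupp _
  rw [e.finrank_eq, ← hc]
  have : Fintype {d : Fin 3 →₀ ℕ | d.degree = n} := by
    have h2 : {d : Fin 3 →₀ ℕ | d.degree = n} = ((Finset.univ : Finset (Fin 3)).finsuppAntidiag n : Set (Fin 3 →₀ ℕ)) := by
      ext d
      simp [Finset.mem_finsuppAntidiag, Finsupp.degree_eq_sum]
    rw [h2]
    infer_instance
  rw [Module.finrank_finsupp_self, Nat.card_eq_fintype_card]

instance (n : ℕ) : FiniteDimensional ℂ (S3 n) :=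
  Module.Finite.iff_fg.mpr (homogeneousSubmodule_fg (Fin 3) ℂ n)

theorem hc_mul {A : MvPolynomial (Fin 3) ℂ} {m : ℕ} (hA : A.IsHomogeneous m)
    (U : MvPolynomial (Fin 3) ℂ) (n : ℕ) :
    homogeneousComponent n (U * A) =
      if m ≤ n then homogeneousComponent (n - m) U * A else 0 := by
  conv_lhs => rw [← sum_homogeneousComponent U, Finset.sum_mul, map_sum]
  have h : ∀ i, homogeneousComponent n (homogeneousComponent i U * A) =
      if i + m = n then homogeneousComponent i U * A else 0 := fun i => by
    rw [homogeneousComponent_of_mem ((homogeneousComponent_isHomogeneous i U).mul hA)]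
    simp [eq_comm]
  simp_rw [h]
  split_ifs with hm
  · by_cases hb : n - m ∈ Finset.range (U.totalDegree + 1)
    · rw [Finset.sum_eq_single (n - m)]
      · simp [hm]
      · intro b _ hb'
        rw [if_neg]; omega
      · exact fun h => absurd hb h
    · rw [Finset.sum_eq_zero, homogeneousComponent_eq_zero, zero_mul]
      · simp at hb; omega
      · intro x hx
        rw [if_neg]
        rintro rfl
        apply hb
        simpa using hx
  · apply Finset.sum_eq_zero
    intro x _
    rw [if_neg]; omega

theorem hom_coeffs {A B G : MvPolynomial (Fin 3) ℂ} {m n : ℕ} (hA : A.IsHomogeneous m)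
    (hB : B.IsHomogeneous m) (hG : G.IsHomogeneous n) (h : ∃ U V, G = U * A + V * B) :
    (n < m → G = 0) ∧ (m ≤ n → ∃ U V : MvPolynomial (Fin 3) ℂ, U.IsHomogeneous (n - m) ∧ V.IsHomogeneous (n - m) ∧
      G = U * A + V * B) := by
  obtain ⟨U, V, rfl⟩ := h
  have h := homogeneousComponent_eq_self hG
  rw [map_add, hc_mul hA, hc_mul hB] at h
  constructor
  · intro hn
    rw [if_neg (by omega), if_neg (by omega)] at h
    rw [← h, add_zero]
  · intro hn
    rw [if_pos hn, if_pos hn] at h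
    exact ⟨_, _, homogeneousComponent_isHomogeneous _ _, homogeneousComponent_isHomogeneous _ _, h.symm⟩

/-- setting the first variable to zero -/
noncomputable def pi0 : MvPolynomial (Fin 3) ℂ →ₐ[ℂ] MvPolynomial (Fin 3) ℂ :=
  aeval (fun i => if i = 0 then 0 else X i)

theorem X0_dvd_sub (p : MvPolynomial (Fin 3) ℂ) : X 0 ∣ p - pi0 p := by
  rw [← Ideal.mem_span_singleton, ← Ideal.Quotient.eq_zero_iff_mem, map_sub, sub_eq_zero]
  have : (Ideal.Quotient.mkₐ ℂ (Ideal.span {(X 0 : MvPolynomial (Fin 3) ℂ)})) =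
      (Ideal.Quotient.mkₐ ℂ (Ideal.span {(X 0 : MvPolynomial (Fin 3) ℂ)})).comp pi0 := by
    apply MvPolynomial.algHom_ext
    intro i
    simp only [pi0, AlgHom.comp_apply, aeval_X]
    split_ifs with h
    · subst h
      rw [map_zero]
      exact Ideal.Quotient.eq_zero_iff_mem.mpr (Ideal.mem_span_singleton_self _)
    · rfl
  exact DFunLike.congr_fun this p

theorem eval_pi0 (p : MvPolynomial (Fin 3) ℂ) (z : Fin 3 → ℂ) :
    eval z (pi0 p) = eval (fun i => if i = 0 then 0 else z i) p := by
  have : (aeval z : MvPolynomial (Fin 3) ℂ →ₐ[ℂ] ℂ).comp pi0 =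
      aeval (fun i => if i = 0 then 0 else z i) := by
    apply MvPolynomial.algHom_ext
    intro i
    simp only [pi0, AlgHom.comp_apply, aeval_X]
    split_ifs with h <;> simp
  have h := DFunLike.congr_fun this p
  simpa [aeval_eq_eval] using h

theorem pi0_X0 : pi0 (X 0) = 0 := by simp [pi0]

theorem pi0_dvd {p : MvPolynomial (Fin 3) ℂ} (h : pi0 p = 0) : X 0 ∣ p := by
  simpa [h] using X0_dvd_sub p

theorem pi0_pi0 (p : MvPolynomial (Fin 3) ℂ) : pi0 (pi0 p) = pi0 p := by
  obtain ⟨q, hq⟩ := X0_dvd_sub p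
  have := congrArg pi0 hq
  rw [map_sub, map_mul, pi0_X0, zero_mul, sub_eq_zero] at this
  exact this.symm

theorem pi0_hom {p : MvPolynomial (Fin 3) ℂ} {n : ℕ} (h : p.IsHomogeneous n) :
    (pi0 p).IsHomogeneous n := by
  have := h.aeval (fun i : Fin 3 => if i = 0 then (0 : MvPolynomial (Fin 3) ℂ) else X i) (n := 1) (by
    intro i
    split_ifs
    · exact isHomogeneous_zero _ _ _
    · exact isHomogeneous_X _ _)
  rw [one_mul] at this
  exact this

theorem pi0_totalDegree (p : MvPolynomial (Fin 3) ℂ) : (pi0 p).totalDegree ≤ p.totalDegree := by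
  conv_lhs => rw [← sum_homogeneousComponent p, map_sum]
  apply totalDegree_finsetSum_le
  intro i hi
  have := (pi0_hom (homogeneousComponent_isHomogeneous i p)).totalDegree_le
  simp at hi
  omega

structure GP (m : ℕ) (A B : MvPolynomial (Fin 3) ℂ) : Prop where
  hm : 1 ≤ m
  hA : A.IsHomogeneous m
  hB : B.IsHomogeneous m
  inf : ∀ z : Fin 3 → ℂ, z 0 = 0 → eval z A = 0 → eval z B = 0 → z = 0
  jac : ∀ z : Fin 3 → ℂ, z 0 = 1 → eval z A = 0 → eval z B = 0 →
    eval z (pderiv 1 A * pderiv 2 B - pderiv 2 A * pderiv 1 B) ≠ 0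

theorem GP.relprime_pi0 {m : ℕ} {A B : MvPolynomial (Fin 3) ℂ} (h : GP m A B) :
    IsRelPrime (pi0 A) (pi0 B) := by
  intro g hgA hgB
  have hz : ∀ z : Fin 3 → ℂ, eval z g = 0 → z 1 = 0 ∧ z 2 = 0 := by
    intro z hz
    have h1 : eval z (pi0 A) = 0 := by
      obtain ⟨q, hq⟩ := hgA
      rw [hq, map_mul, hz, zero_mul]
    have h2 : eval z (pi0 B) = 0 := by
      obtain ⟨q, hq⟩ := hgB
      rw [hq, map_mul, hz, zero_mul]
    rw [eval_pi0] at h1 h2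
    have := h.inf _ (by simp) h1 h2
    exact ⟨by simpa using congrFun this 1, by simpa using congrFun this 2⟩
  have hrad : ∀ i : Fin 3, i ≠ 0 → ∃ n : ℕ, g ∣ X i ^ n := by
    intro i hi
    have : (X i : MvPolynomial (Fin 3) ℂ) ∈ (Ideal.span {g}).radical := by
      rw [← vanishingIdeal_zeroLocus_eq_radical (K := ℂ)]
      rw [mem_vanishingIdeal_iff]
      intro z hzz
      have : eval z g = 0 := by
        have := hzz g (Ideal.mem_span_singleton_self g)
        simpa [aeval_eq_eval] using this
      have := hz z this
      fin_cases i
      · exact absurd rfl hi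
      · simpa using this.1
      · simpa using this.2
    obtain ⟨n, hn⟩ := this
    exact ⟨n, Ideal.mem_span_singleton.mp hn⟩
  obtain ⟨n1, h1⟩ := hrad 1 (by decide)
  obtain ⟨n2, h2⟩ := hrad 2 (by decide)
  have : IsRelPrime (X 1 : MvPolynomial (Fin 3) ℂ) (X 2) := by
    rw [(X_prime (R := ℂ) (i := (1 : Fin 3))).irreducible.isRelPrime_iff_not_dvd]
    rw [X_dvd_X]
    simp
  exact (this.pow (m := n1) (n := n2)) h1 h2
  
theorem GP.reduce {m : ℕ} {A B : MvPolynomial (Fin 3) ℂ} (h : GP m A B)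
    {U V G : MvPolynomial (Fin 3) ℂ} (hG : X 0 * G = U * A + V * B) :
    ∃ C U' V', U = C * B + X 0 * U' ∧ V = - C * A + X 0 * V' ∧ G = U' * A + V' * B ∧ 
      (pi0 U = C * pi0 B) := by
  have h0 : pi0 U * pi0 A + pi0 V * pi0 B = 0 := by
    have := congrArg pi0 hG
    simpa [pi0_X0] using this.symm
  have hB : pi0 B ≠ 0 := by
    intro hB
    have := h.relprime_pi0
    rw [hB] at this
    rw [isRelPrime_zero_right] at this
    have hm := h.hm
    rw [MvPolynomial.isUnit_iff_eq_C_of_isReduced] at this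
    obtain ⟨r, hr, hr2⟩ := this
    have hh := pi0_hom h.hA
    rw [hr2] at hh
    have := (isHomogeneous_C (Fin 3) r).inj_right hh (by simpa using hr.ne_zero)
    omega
  have hdvd : pi0 B ∣ pi0 U := by
    apply h.relprime_pi0.symm.dvd_of_dvd_mul_right
    exact ⟨- pi0 V, by linear_combination h0⟩
  obtain ⟨C', hC'⟩ := hdvd
  have hC : pi0 U = pi0 C' * pi0 B := by
    have := congrArg pi0 hC'
    rw [map_mul, pi0_pi0, pi0_pi0] at this
    rw [this, mul_comm]
  have hV : pi0 V = - pi0 C' * pi0 A := by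
    apply mul_right_cancel₀ hB
    rw [hC] at h0
    linear_combination h0
  obtain ⟨U', hU'⟩ := pi0_dvd (p := U - pi0 C' * B) (by simp [pi0_pi0, hC])
  obtain ⟨V', hV'⟩ := pi0_dvd (p := V + pi0 C' * A) (by simp [pi0_pi0, hV])
  refine ⟨pi0 C', U', V', by linear_combination hU', by linear_combination hV', ?_, hC⟩
  apply mul_left_cancel₀ (X_ne_zero (R := ℂ) (0 : Fin 3))
  rw [hG]
  linear_combination A * hU' + B * hV'

theorem GP.divX {m : ℕ} {A B : MvPolynomial (Fin 3) ℂ} (h : GP m A B) (e : ℕ) 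
    {G : MvPolynomial (Fin 3) ℂ} (hG : ∃ U V, X 0 ^ e * G = U * A + V * B) :
    ∃ U V, G = U * A + V * B := by
  induction e with
  | zero => simpa using hG
  | succ e ih =>
    apply ih
    obtain ⟨U, V, hUV⟩ := hG
    obtain ⟨_, U', V', _, _, h3, _⟩ := h.reduce (G := X 0 ^ e * G) (by rw [← hUV]; ring)
    exact ⟨U', V', h3⟩

theorem GP.syz {m : ℕ} {A B : MvPolynomial (Fin 3) ℂ} (h : GP m A B) : ∀ (n : ℕ)
    {U V : MvPolynomial (Fin 3) ℂ}, U.totalDegree < n → U * A + V * B = 0 → ∃ C, U = C * B := by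
  intro n
  induction n with
  | zero => intro U V hU; omega
  | succ n ih =>
    intro U V hU hUV
    obtain ⟨C, U', V', h1, h2, h3, h4⟩ := h.reduce (G := 0) (U := U) (V := V) (by simp [hUV])
    by_cases hU' : U' = 0
    · exact ⟨C, by rw [h1, hU']; ring⟩
    have hd : (C * B).totalDegree ≤ U.totalDegree := by
      by_cases hC : C = 0
      · simp [hC]
      have hB : pi0 B ≠ 0 := by
        intro hB
        have hr := h.relprime_pi0
        rw [hB, isRelPrime_zero_right] at hr
        have hm := h.hm
        rw [MvPolynomial.isUnit_iff_eq_C_of_isReduced] at hr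
        obtain ⟨r, hr, hr2⟩ := hr
        have hh := pi0_hom h.hA
        rw [hr2] at hh
        have := (isHomogeneous_C (Fin 3) r).inj_right hh (by simpa using hr.ne_zero)
        omega
      have hB' : B ≠ 0 := by rintro rfl; simp at hB
      rw [totalDegree_mul_of_isDomain hC hB', h.hB.totalDegree hB', 
        ← (pi0_hom h.hB).totalDegree hB, ← totalDegree_mul_of_isDomain hC hB, ← h4]
      exact pi0_totalDegree U
    have hd2 : (X 0 * U').totalDegree ≤ U.totalDegree := by
      have : X 0 * U' = U - C * B := by rw [h1]; ring
      rw [this]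
      exact (totalDegree_sub _ _).trans (max_le le_rfl hd)
    rw [totalDegree_mul_of_isDomain (X_ne_zero _) hU', totalDegree_X] at hd2
    obtain ⟨C', hC'⟩ := ih (U := U') (V := V') (by omega) h3.symm
    exact ⟨C + X 0 * C', by rw [h1, hC']; ring⟩

theorem GP.syz' {m : ℕ} {A B : MvPolynomial (Fin 3) ℂ} (h : GP m A B) 
    {U V : MvPolynomial (Fin 3) ℂ} (hUV : U * A + V * B = 0) : ∃ C, U = C * B :=
  h.syz _ (Nat.lt_succ_self _) hUV

theorem GP.A_ne {m : ℕ} {A B : MvPolynomial (Fin 3) ℂ} (h : GP m A B) : A ≠ 0 := by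
  rintro rfl
  obtain ⟨C, hC⟩ := h.syz' (U := 1) (V := 0) (by simp)
  have hB : IsUnit B := IsUnit.of_mul_eq_one C (by rw [mul_comm]; exact hC.symm)
  rw [MvPolynomial.isUnit_iff_eq_C_of_isReduced] at hB
  obtain ⟨r, hr, hr2⟩ := hB
  have hh := h.hB
  have hm := h.hm
  rw [hr2] at hh
  have := (isHomogeneous_C (Fin 3) r).inj_right hh (by simpa using hr.ne_zero)
  omega

theorem GP.relprime {m : ℕ} {A B : MvPolynomial (Fin 3) ℂ} (h : GP m A B) : IsRelPrime A B := by
  rintro g ⟨a, ha⟩ ⟨b, hb⟩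
  obtain ⟨C, hC⟩ := h.syz' (U := b) (V := -a) (by rw [ha, hb]; ring)
  by_cases hb0 : b = 0
  · obtain ⟨C, hC⟩ := h.syz' (U := 0) (V := 1) (by rw [hb, hb0]; simp)
    have := h.relprime_pi0
    rw [hb, hb0] at this
    simp only [mul_zero, map_zero, isRelPrime_zero_right] at this
    rw [MvPolynomial.isUnit_iff_eq_C_of_isReduced] at this
    obtain ⟨r, hr, hr2⟩ := this
    have hh := pi0_hom h.hA
    have hm := h.hm
    rw [hr2] at hh
    have := (isHomogeneous_C (Fin 3) r).inj_right hh (by simpa using hr.ne_zero)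
    omega
  · apply IsUnit.of_mul_eq_one C
    apply mul_right_cancel₀ hb0
    rw [hb] at hC
    linear_combination -hC

end

section

theorem taylor2 (c : Fin 3 → ℂ) (p : MvPolynomial (Fin 3) ℂ) :
    p - C (eval c p) - ∑ j, C (eval c (pderiv j p)) * (X j - C (c j)) ∈
      (vanishingIdeal ℂ {c} : Ideal (MvPolynomial (Fin 3) ℂ)) ^ 2 := by
  have hX : ∀ j, (X j - C (c j) : MvPolynomial (Fin 3) ℂ) ∈ (vanishingIdeal ℂ {c} : Ideal (MvPolynomial (Fin 3) ℂ)) := by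
    intro j
    rw [mem_vanishingIdeal_singleton_iff]
    simp
  induction p using MvPolynomial.induction_on with
  | C a => simp
  | add p q hp hq =>
    have e : ∀ a b c d f g : MvPolynomial (Fin 3) ℂ, (a + b) - (c + d) - (f + g) =
      (a - c - f) + (b - d - g) := by intros; ring
    simp only [map_add, add_mul, Finset.sum_add_distrib]
    rw [e]
    exact Ideal.add_mem _ hp hq
  | mul_X p i hp =>
    have h1 := Ideal.mul_mem_right (X i) _ hp
    have h2 : (∑ j, C (eval c (pderiv j p)) * (X j - C (c j))) * (X i - C (c i)) ∈ 
       (vanishingIdeal ℂ {c} : Ideal (MvPolynomial (Fin 3) ℂ)) ^ 2 := by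
      rw [pow_two]
      apply Ideal.mul_mem_mul _ (hX i)
      exact Ideal.sum_mem _ fun j _ => Ideal.mul_mem_left _ _ (hX j)
    have h3 : ∀ j, C (eval c (pderiv j (p * X i))) * (X j - C (c j)) =
      (C (eval c (pderiv j p)) * (X j - C (c j))) * C (c i) 
        + (if j = i then C (eval c p) * (X i - C (c i)) else 0 : MvPolynomial (Fin 3) ℂ) := by
      intro j
      rw [pderiv_mul, pderiv_X]
      by_cases h : j = i
      · subst h
        simp only [map_add, map_mul, eval_X, Pi.single_eq_same, if_true]
        simp
        ring
      · rw [if_neg h]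
        have : Pi.single (M := fun _ => MvPolynomial (Fin 3) ℂ) j 1 i = 0 := Pi.single_eq_of_ne (Ne.symm h) _
        simp [this]
        ring
    simp_rw [h3]
    rw [Finset.sum_add_distrib, ← Finset.sum_mul, Finset.sum_ite_eq' Finset.univ i]
    simp only [Finset.mem_univ, if_true, map_mul, eval_X]
    have h4 := Ideal.add_mem _ h1 h2
    generalize (∑ j, C (eval c (pderiv j p)) * (X j - C (c j))) = L at h4 ⊢
    have e : p * X i - C (eval c p) * C (c i) - (L * C (c i) + C (eval c p) * (X i - C (c i))) =
      (p - C (eval c p) - L) * X i + L * (X i - C (c i)) := by ring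
    rw [e]
    exact h4

theorem GP.mem3 {m : ℕ} {A B : MvPolynomial (Fin 3) ℂ} (h : GP m A B)
    {G : MvPolynomial (Fin 3) ℂ} 
    (hG : ∀ z : Fin 3 → ℂ, z 0 = 1 → eval z A = 0 → eval z B = 0 → eval z G = 0) :
    ∃ U V T, G = U * A + V * B + T * (X 0 - 1) := by
  set I : Ideal (MvPolynomial (Fin 3) ℂ) := Ideal.span {A, B, X 0 - 1} with hI
  have hAI : A ∈ I := Ideal.subset_span (by simp)
  have hBI : B ∈ I := Ideal.subset_span (by simp)
  have hXI : X 0 - 1 ∈ I := Ideal.subset_span (by simp)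
  suffices hGI : G ∈ I by
    rw [hI, Ideal.mem_span_insert] at hGI
    obtain ⟨U, z, hz, rfl⟩ := hGI
    rw [Ideal.mem_span_pair] at hz
    obtain ⟨V, T, rfl⟩ := hz
    exact ⟨U, V, T, by ring⟩
  by_contra hGI
  set K : Ideal (MvPolynomial (Fin 3) ℂ) := I.colon {G} with hK
  have hKm : ∀ x, x ∈ K ↔ x * G ∈ I := by
    intro x; simp [hK, Submodule.mem_colon_singleton]
  have hKne : K ≠ ⊤ := by
    intro hh
    have : (1 : MvPolynomial (Fin 3) ℂ) ∈ K := by rw [hh]; trivial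
    rw [hKm, one_mul] at this
    exact hGI this
  obtain ⟨M, hM, hKM⟩ := Ideal.exists_le_maximal K hKne
  obtain ⟨c, rfl⟩ := isMaximal_iff_eq_vanishingIdeal_singleton.mp hM
  have hIK : ∀ x ∈ I, x ∈ K := fun x hx => by rw [hKm]; exact Ideal.mul_mem_right _ _ hx
  have hev : ∀ x ∈ I, eval c x = 0 := fun x hx => by
    have := hKM (hIK x hx)
    rw [mem_vanishingIdeal_singleton_iff] at this
    simpa [aeval_eq_eval] using this
  have hc0 : c 0 = 1 := by
    have := hev _ hXI
    simpa [sub_eq_zero] using this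
  have hcA := hev _ hAI
  have hcB := hev _ hBI
  have hjac := h.jac c hc0 hcA hcB
  set m' := (vanishingIdeal ℂ {c} : Ideal (MvPolynomial (Fin 3) ℂ)) with hm'
  set J := I ⊔ m' ^ 2 with hJ
  have hlin : ∀ p ∈ I, ∑ j, C (eval c (pderiv j p)) * (X j - C (c j)) ∈ J := by
    intro p hp
    have h1 := taylor2 c p
    rw [hev p hp] at h1
    have h2 : p ∈ J := Ideal.mem_sup_left hp
    have h3 := Ideal.sub_mem _ h2 (Ideal.mem_sup_right h1 : _ ∈ J)
    simpa using h3
  have hY0 : (X 0 - C (c 0) : MvPolynomial (Fin 3) ℂ) ∈ J := by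
    rw [hc0]; exact Ideal.mem_sup_left hXI
  have hA1 := Ideal.sub_mem _ (hlin A hAI) (Ideal.mul_mem_left _ (C (eval c (pderiv 0 A))) hY0)
  have hB1 := Ideal.sub_mem _ (hlin B hBI) (Ideal.mul_mem_left _ (C (eval c (pderiv 0 B))) hY0)
  simp only [Fin.sum_univ_three] at hA1 hB1
  rw [map_sub, map_mul, map_mul] at hjac
  set D := (eval c (pderiv 1 A) * eval c (pderiv 2 B) - eval c (pderiv 2 A) * eval c (pderiv 1 B)) with hD
  have hinv : (C D⁻¹ * C D : MvPolynomial (Fin 3) ℂ) = 1 := by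
    rw [← C_mul, inv_mul_cancel₀ hjac, C_1]
  have hY1 : (X 1 - C (c 1) : MvPolynomial (Fin 3) ℂ) ∈ J := by
    have := Ideal.mul_mem_left _ (C D⁻¹) (Ideal.sub_mem _ (Ideal.mul_mem_left _ (C (eval c (pderiv 2 B))) hA1)
      (Ideal.mul_mem_left _ (C (eval c (pderiv 2 A))) hB1))
    convert! this using 1
    rw [hD] at hinv ⊢
    simp only [C_sub, C_mul] at hinv ⊢
    linear_combination (-(X 1 - C (c 1))) * hinv
  have hY2 : (X 2 - C (c 2) : MvPolynomial (Fin 3) ℂ) ∈ J := by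
    have := Ideal.mul_mem_left _ (C D⁻¹) (Ideal.sub_mem _ (Ideal.mul_mem_left _ (C (eval c (pderiv 1 A))) hB1)
      (Ideal.mul_mem_left _ (C (eval c (pderiv 1 B))) hA1))
    convert! this using 1
    rw [hD] at hinv ⊢
    simp only [C_sub, C_mul] at hinv ⊢
    linear_combination (-(X 2 - C (c 2))) * hinv
  have hmJ : m' ≤ J := by
    intro p hp
    have hp0 : eval c p = 0 := by
      rw [hm', mem_vanishingIdeal_singleton_iff] at hp
      simpa [aeval_eq_eval] using hp
    have h1 := taylor2 c p
    rw [hp0] at h1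
    have h2 : ∑ j, C (eval c (pderiv j p)) * (X j - C (c j)) ∈ J := by
      apply Ideal.sum_mem
      intro j _
      apply Ideal.mul_mem_left
      fin_cases j
      · exact hY0
      · exact hY1
      · exact hY2
    have h3 := Ideal.add_mem _ h2 (Ideal.mem_sup_right h1 : _ ∈ J)
    simpa using h3
  obtain ⟨r, hr1, hr2⟩ := Submodule.exists_sub_one_mem_and_smul_le_of_fg_of_le_sup (I := m') (N := I) (N' := m') (P := m')
    (IsNoetherian.noetherian m') le_rfl (by
      rw [smul_eq_mul, ← pow_two]; exact hmJ)
  have hGm : G ∈ m' := by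
    rw [hm', mem_vanishingIdeal_singleton_iff]
    simpa [aeval_eq_eval] using hG c hc0 hcA hcB
  have hrG : r * G ∈ I := hr2 (Submodule.smul_mem_pointwise_smul _ _ _ hGm)
  have hrK : r ∈ m' := hKM ((hKm r).mpr hrG)
  have : (1 : MvPolynomial (Fin 3) ℂ) ∈ m' := by
    have := Ideal.sub_mem _ hrK hr1
    simpa using this
  exact hM.ne_top ((Ideal.eq_top_iff_one _).mpr this)

/-- homogenization with respect to the first variable -/
noncomputable def hz (n : ℕ) (p : MvPolynomial (Fin 3) ℂ) : MvPolynomial (Fin 3) ℂ :=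
  ∑ i ∈ Finset.range (n + 1), homogeneousComponent i p * X 0 ^ (n - i)

theorem hz_hom (n : ℕ) (p : MvPolynomial (Fin 3) ℂ) : (hz n p).IsHomogeneous n := by
  apply IsHomogeneous.sum
  intro i hi
  have := (homogeneousComponent_isHomogeneous i p).mul (isHomogeneous_X_pow (R := ℂ) (0 : Fin 3) (n - i))
  simp at hi
  rwa [show i + (n - i) = n by omega] at this

theorem hz_eval {n : ℕ} {p : MvPolynomial (Fin 3) ℂ} (hn : p.totalDegree ≤ n) {z : Fin 3 → ℂ} (h0 : z 0 = 1) :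
    eval z (hz n p) = eval z p := by
  conv_rhs => rw [← sum_homogeneousComponent p]
  rw [hz, map_sum, map_sum]
  symm
  rw [Finset.sum_subset (Finset.range_subset_range.mpr (by omega : p.totalDegree + 1 ≤ n + 1))]
  · apply Finset.sum_congr rfl
    intro i _
    simp [h0]
  · intro i _ hi
    simp at hi
    rw [homogeneousComponent_eq_zero _ _ (by omega)]; simp

theorem hom_smul {K : Type} [Field K] {n : ℕ} {p : MvPolynomial (Fin 3) K} (hp : p.IsHomogeneous n)
    (a : K) (z : Fin 3 → K) : eval (a • z) p = a ^ n * eval z p := by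
  rw [eval_eq', eval_eq', Finset.mul_sum]
  apply Finset.sum_congr rfl
  intro d hd
  have h1 : d.degree = n := by
    by_contra h
    exact (mem_support_iff.mp hd) (hp.coeff_eq_zero h)
  simp only [Pi.smul_apply, smul_eq_mul, mul_pow, Finset.prod_mul_distrib]
  rw [Finset.prod_pow_eq_pow_sum, ← h1, Finsupp.degree_eq_sum]
  ring

theorem hom_eq_zero {n : ℕ} {p : MvPolynomial (Fin 3) ℂ} (hp : p.IsHomogeneous n)
    (h : ∀ z : Fin 3 → ℂ, z 0 = 1 → eval z p = 0) : p = 0 := by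
  have : X 0 * p = 0 := by
    apply MvPolynomial.funext
    intro z
    by_cases hz : z 0 = 0
    · simp [hz]
    · have h1 := h ((z 0)⁻¹ • z) (by simp [hz])
      have h2 : eval ((z 0)⁻¹ • z) p = (z 0)⁻¹ ^ n * eval z p := by
        exact hom_smul hp _ _
      rw [h2] at h1
      have := (mul_eq_zero.mp h1).resolve_left (pow_ne_zero _ (inv_ne_zero hz))
      simp [this]
  exact (mul_eq_zero.mp this).resolve_left (X_ne_zero _)

theorem GP.mem {m : ℕ} {A B : MvPolynomial (Fin 3) ℂ} (h : GP m A B) {n : ℕ}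
    {G : MvPolynomial (Fin 3) ℂ} (hGh : G.IsHomogeneous n)
    (hG : ∀ z : Fin 3 → ℂ, z 0 = 1 → eval z A = 0 → eval z B = 0 → eval z G = 0) :
    ∃ U V, G = U * A + V * B := by
  obtain ⟨U, V, T, hUVT⟩ := h.mem3 hG
  set e := U.totalDegree + V.totalDegree + n with he
  apply h.divX (m + e - n) 
  refine ⟨hz e U, hz e V, ?_⟩
  rw [← sub_eq_zero]
  apply hom_eq_zero (n := m + e)
  · apply IsHomogeneous.sub
    · have := (isHomogeneous_X_pow (R := ℂ) (0 : Fin 3) (m + e - n)).mul hGh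
      rwa [show m + e - n + n = m + e by omega] at this
    · apply IsHomogeneous.add
      · rw [add_comm]; exact (hz_hom e U).mul h.hA
      · rw [add_comm]; exact (hz_hom e V).mul h.hB
  · intro z hz0
    simp only [map_sub, map_add, map_mul, map_pow, eval_X, hz0]
    rw [hz_eval (by omega) hz0, hz_eval (by omega) hz0, hUVT]
    simp [hz0]

end

section

noncomputable def phi (a b j : ℕ) (A B : MvPolynomial (Fin 3) ℂ) :
    (S3 (j + b) × S3 (j + a)) →ₗ[ℂ] MvPolynomial (Fin 3) ℂ where
  toFun p := p.1.1 * A + p.2.1 * B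
  map_add' p q := by simp; ring
  map_smul' c p := by simp

noncomputable def psi {a b : ℕ} (j : ℕ) {A B : MvPolynomial (Fin 3) ℂ} (hA : A.IsHomogeneous a)
    (hB : B.IsHomogeneous b) : S3 j →ₗ[ℂ] (S3 (j + b) × S3 (j + a)) where
  toFun p := (⟨p.1 * B, IsHomogeneous.mul p.2 hB⟩, ⟨-(p.1 * A), (IsHomogeneous.mul p.2 hA).neg⟩)
  map_add' p q := by
    ext1 <;> ext1 <;> simp <;> ring
  map_smul' c p := by
    ext1 <;> ext1 <;> simp

theorem finrank_phi {a b : ℕ} (j : ℕ) {A B : MvPolynomial (Fin 3) ℂ} (hA : A.IsHomogeneous a)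
    (hB : B.IsHomogeneous b) (hB0 : B ≠ 0) (hr : IsRelPrime A B) :
    Module.finrank ℂ (LinearMap.range (phi a b j A B)) + (j + 2).choose 2 =
      (j + b + 2).choose 2 + (j + a + 2).choose 2 := by
  have h1 := LinearMap.finrank_range_add_finrank_ker (phi a b j A B)
  rw [Module.finrank_prod, finrank_S3, finrank_S3] at h1
  rw [← h1]
  congr 1
  have hinj : Function.Injective (psi j hA hB) := by
    rw [injective_iff_map_eq_zero]
    intro p hp
    have := congrArg (fun x => x.1.1) hp
    have h2 : p.1 * B = 0 := this
    exact Subtype.ext ((mul_eq_zero.mp h2).resolve_right hB0)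
  have hrange : LinearMap.range (psi j hA hB) = LinearMap.ker (phi a b j A B) := by
    ext ⟨u, v⟩
    constructor
    · rintro ⟨p, hp⟩
      rw [← hp, LinearMap.mem_ker]
      change (p.1 * B) * A + (-(p.1 * A)) * B = 0
      ring
    · intro h
      rw [LinearMap.mem_ker] at h
      have h : u.1 * A + v.1 * B = 0 := h
      have hd : B ∣ u.1 := by
        apply hr.symm.dvd_of_dvd_mul_right
        exact ⟨-v.1, by linear_combination h⟩
      obtain ⟨c, hc⟩ := hd
      have h2 := homogeneousComponent_eq_self u.2
      have h4 : j + b - b = j := by omega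
      conv_lhs at h2 => rw [hc, mul_comm, hc_mul hB]
      rw [if_pos (by omega), h4] at h2
      refine ⟨⟨homogeneousComponent j c, homogeneousComponent_isHomogeneous _ _⟩, ?_⟩
      ext1
      · exact Subtype.ext h2
      · apply Subtype.ext
        change -(homogeneousComponent j c * A) = v.1
        apply mul_right_cancel₀ hB0
        rw [← h2] at h
        linear_combination -h
  rw [← hrange, LinearMap.finrank_range_of_inj hinj, finrank_S3]

theorem exists_sep (T : Finset (Fin 3 → ℂ)) (hT : ∀ z ∈ T, z 0 = 1) (n : ℕ) (hn : T.card ≤ n)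
    (c : Fin 3 → ℂ) (hc : c ∈ T) : ∃ H : MvPolynomial (Fin 3) ℂ, H.IsHomogeneous n ∧ eval c H ≠ 0 ∧
      ∀ z ∈ T, z ≠ c → eval z H = 0 := by
  classical
  have hl : ∀ z : Fin 3 → ℂ, ∃ l : MvPolynomial (Fin 3) ℂ, l.IsHomogeneous 1 ∧ (z ∈ T → z ≠ c → eval z l = 0 ∧ eval c l ≠ 0) := by
    intro z
    by_cases hz : z = c
    · exact ⟨0, isHomogeneous_zero _ _ _, fun _ h => absurd hz h⟩
    obtain ⟨i, hi⟩ := Function.ne_iff.mp hz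
    refine ⟨X i - C (z i) * X 0, (isHomogeneous_X _ _).sub (isHomogeneous_C_mul_X _ _), ?_⟩
    intro hzT _
    simp only [map_sub, map_mul, eval_X, eval_C, hT z hzT, hT c hc]
    constructor
    · ring
    · rw [mul_one, sub_ne_zero]; exact Ne.symm hi
  choose l hl1 hl2 using hl
  refine ⟨(∏ z ∈ T.erase c, l z) * X 0 ^ (n - (T.erase c).card), ?_, ?_, ?_⟩
  · have h1 := IsHomogeneous.prod (T.erase c) l (fun _ => 1) (fun i _ => hl1 i)
    have h2 := h1.mul (isHomogeneous_X_pow (R := ℂ) (0 : Fin 3) (n - (T.erase c).card))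
    have := Finset.card_erase_le (s := T) (a := c)
    rw [Finset.sum_const, smul_eq_mul, mul_one, show (T.erase c).card + (n - (T.erase c).card) = n by omega] at h2
    exact h2
  · rw [map_mul, map_pow, eval_X, hT c hc, one_pow, mul_one, eval_prod, Finset.prod_ne_zero_iff]
    intro z hz
    rw [Finset.mem_erase] at hz
    exact (hl2 z hz.2 hz.1).2
  · intro z hz hzc
    rw [map_mul, eval_prod, Finset.prod_eq_zero (Finset.mem_erase.mpr ⟨hzc, hz⟩) (hl2 z hz hzc).1, zero_mul]

noncomputable def evT (n : ℕ) (T : Finset (Fin 3 → ℂ)) : S3 n →ₗ[ℂ] (T → ℂ) where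
  toFun p := fun z => eval z.1 p.1
  map_add' p q := by ext; simp
  map_smul' c p := by ext; simp [smul_eval]

theorem evT_surj (T : Finset (Fin 3 → ℂ)) (hT : ∀ z ∈ T, z 0 = 1) (n : ℕ) (hn : T.card ≤ n) :
    Function.Surjective (evT n T) := by
  classical
  intro f
  have h := exists_sep T hT n hn
  choose! H h1 h2 h3 using h
  refine ⟨∑ c : T, (f c / eval c.1 (H c.1)) • ⟨H c.1, h1 c.1 c.2⟩, ?_⟩
  ext z
  rw [map_sum, Finset.sum_apply, Finset.sum_eq_single z]
  · rw [map_smul]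
    change (f z / eval z.1 (H z.1)) * eval z.1 (H z.1) = f z
    field_simp [h2 z.1 z.2]
  · intro b _ hb
    rw [map_smul]
    change (f b / eval b.1 (H b.1)) * eval z.1 (H b.1) = 0
    rw [h3 b.1 b.2 z.1 z.2 (fun h => hb (Subtype.ext h.symm)), mul_zero]
  · simp

theorem choose_two_eq (n : ℕ) : 2 * (n + 2).choose 2 = (n + 2) * (n + 1) := by
  rw [Nat.choose_two_right, Nat.mul_div_cancel']
  · simp
  · have := (Nat.even_mul_pred_self (n + 2)).two_dvd
    exact this

theorem GP.B_ne {m : ℕ} {A B : MvPolynomial (Fin 3) ℂ} (h : GP m A B) : B ≠ 0 := by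
  rintro rfl
  have := h.relprime
  rw [isRelPrime_zero_right, MvPolynomial.isUnit_iff_eq_C_of_isReduced] at this
  obtain ⟨r, hr, hr2⟩ := this
  have hh := h.hA
  have hm := h.hm
  rw [hr2] at hh
  have := (isHomogeneous_C (Fin 3) r).inj_right hh (by simpa using hr.ne_zero)
  omega

theorem GP.card_le {m : ℕ} {A B : MvPolynomial (Fin 3) ℂ} (h : GP m A B) (T : Finset (Fin 3 → ℂ))
    (hT : ∀ z ∈ T, z 0 = 1 ∧ eval z A = 0 ∧ eval z B = 0) : T.card ≤ m * m := by
  set j := T.card with hj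
  have hs := evT_surj T (fun z hz => (hT z hz).1) (j + m + m) (by omega)
  have h1 := LinearMap.finrank_range_add_finrank_ker (evT (j + m + m) T)
  rw [LinearMap.range_eq_top.mpr hs, finrank_top, finrank_S3, Module.finrank_fintype_fun_eq_card, Fintype.card_coe] at h1
  have h2 := finrank_phi j h.hA h.hB h.B_ne h.relprime
  have h3 : Module.finrank ℂ (LinearMap.range (phi m m j A B)) ≤ Module.finrank ℂ (LinearMap.ker (evT (j + m + m) T)) := by
    have hle : LinearMap.range (phi m m j A B) ≤ (LinearMap.ker (evT (j + m + m) T)).map (S3 (j + m + m)).subtype := by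
      rintro _ ⟨⟨u, v⟩, rfl⟩
      refine ⟨⟨u.1 * A + v.1 * B, ?_⟩, ?_, rfl⟩
      · exact (IsHomogeneous.mul u.2 h.hA).add (IsHomogeneous.mul v.2 h.hB)
      · rw [SetLike.mem_coe, LinearMap.mem_ker]
        ext z
        change eval z.1 (u.1 * A + v.1 * B) = 0
        simp [(hT z.1 z.2).2.1, (hT z.1 z.2).2.2]
    have := Submodule.finrank_mono hle
    exact this.trans (Submodule.finrank_map_le _ _)
  have e0 := choose_two_eq j
  have e1 := choose_two_eq (j + m)
  have e2 := choose_two_eq (j + m + m)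
  nlinarith

theorem GP.exists_t {m : ℕ} {A B : MvPolynomial (Fin 3) ℂ} (h : GP m A B) {g : MvPolynomial (Fin 3) ℂ}
    (hg : g ≠ 0) : ∃ t : ℂ, IsRelPrime g (A + C t * B) := by
  classical
  by_contra hcon
  push Not at hcon
  have : ∀ t : ℂ, ∃ p ∈ UniqueFactorizationMonoid.factors g, p ∣ A + C t * B := by
    intro t
    have := hcon t
    have h2 := mt (UniqueFactorizationMonoid.isRelPrime_iff_no_prime_factors hg).mpr this
    push Not at h2
    obtain ⟨d, hd1, hd2, hd3⟩ := h2
    obtain ⟨q, hq, hq2⟩ := UniqueFactorizationMonoid.exists_mem_factors_of_dvd hg hd3.irreducible hd1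
    exact ⟨q, hq, hq2.symm.dvd.trans hd2⟩
  choose p hp1 hp2 using this
  obtain ⟨t1, t2, hne, heq⟩ := Finite.exists_ne_map_eq_of_infinite
    (fun t => (⟨p t, Multiset.mem_toFinset.mpr (hp1 t)⟩ : (UniqueFactorizationMonoid.factors g).toFinset))
  have heq : p t1 = p t2 := by simpa using heq
  have d1 := hp2 t1
  have d2 := hp2 t2
  rw [← heq] at d2
  have hu : (C (t1 - t2)⁻¹ * C (t1 - t2) : MvPolynomial (Fin 3) ℂ) = 1 := by
    rw [← C_mul, inv_mul_cancel₀ (sub_ne_zero.mpr hne), C_1]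
  have hB : p t1 ∣ B := by
    have := (dvd_sub d1 d2).mul_left (C (t1 - t2)⁻¹)
    have e : C (t1 - t2)⁻¹ * (A + C t1 * B - (A + C t2 * B)) = B := by
      rw [C_sub] at hu
      linear_combination B * hu
    rwa [e] at this
  have hA : p t1 ∣ A := by
    have := dvd_sub d1 (hB.mul_left (C t1))
    simpa using this
  exact (UniqueFactorizationMonoid.irreducible_of_factor _ (hp1 t1)).not_isUnit (h.relprime hA hB)

theorem GP.no_form {m : ℕ} {A B : MvPolynomial (Fin 3) ℂ} (h : GP m A B) {e : ℕ} (he : e ≤ m)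
    {g : MvPolynomial (Fin 3) ℂ} (hg : g ≠ 0) (hgh : g.IsHomogeneous e) (Z : Finset (Fin 3 → ℂ))
    (hZ : ∀ z : Fin 3 → ℂ, z 0 = 1 → eval z A = 0 → eval z B = 0 → z ∉ Z → eval z g = 0) :
    m * (m - e) ≤ Z.card := by
  obtain ⟨t, ht⟩ := h.exists_t hg
  set H := A + C t * B with hH
  have hHh : H.IsHomogeneous m := h.hA.add (by simpa using h.hB.C_mul t)
  obtain ⟨f, rfl⟩ : ∃ f, m = e + f := ⟨m - e, by omega⟩
  have hH0 : H ≠ 0 := by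
    intro h0
    have hr := h.relprime
    have : IsUnit B := by
      apply hr _ dvd_rfl
      refine ⟨-C t, ?_⟩
      rw [hH] at h0
      linear_combination h0
    rw [MvPolynomial.isUnit_iff_eq_C_of_isReduced] at this
    obtain ⟨r, hr, hr2⟩ := this
    have hh := h.hB
    have hm := h.hm
    rw [hr2] at hh
    have := (isHomogeneous_C (Fin 3) r).inj_right hh (by simpa using hr.ne_zero)
    omega
  have h1 := finrank_phi f hgh hHh hH0 ht
  have h2 := finrank_phi 0 h.hA h.hB h.B_ne h.relprime
  set V := LinearMap.range (phi e (e + f) f g H) with hV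
  let E : V →ₗ[ℂ] (Z → ℂ) :=
    { toFun := fun p z => eval z.1 p.1
      map_add' := fun p q => by ext; simp
      map_smul' := fun c p => by ext; simp [smul_eval] }
  have hfd : FiniteDimensional ℂ V := by
    rw [hV]; infer_instance
  have h3 := LinearMap.finrank_range_add_finrank_ker E
  have h4 : Module.finrank ℂ (LinearMap.range E) ≤ Z.card := by
    have := Submodule.finrank_le (LinearMap.range E)
    simpa [Module.finrank_fintype_fun_eq_card] using this
  have h5 : Module.finrank ℂ (LinearMap.ker E) ≤ Module.finrank ℂ (LinearMap.range (phi (e + f) (e + f) 0 A B)) := by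
    have hle : (LinearMap.ker E).map V.subtype ≤ LinearMap.range (phi (e + f) (e + f) 0 A B) := by
      rintro _ ⟨⟨p, hp⟩, hpk, rfl⟩
      change p ∈ _
      have hpz : ∀ z ∈ Z, eval z p = 0 := by
        intro z hz
        have := congrFun (LinearMap.mem_ker.mp hpk) ⟨z, hz⟩
        exact this
      obtain ⟨⟨u, v⟩, huv⟩ := hp
      have huv : u.1 * g + v.1 * H = p := huv
      have hph : p.IsHomogeneous (f + (e + f) + e) := by
        rw [← huv]
        apply IsHomogeneous.add
        · exact IsHomogeneous.mul u.2 hgh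
        · rw [show f + (e + f) + e = f + e + (e + f) by ring]
          exact IsHomogeneous.mul v.2 hHh
      have hmem := h.mem hph (by
        intro z h0 hzA hzB
        by_cases hzZ : z ∈ Z
        · exact hpz z hzZ
        · rw [← huv, map_add, map_mul, map_mul, hZ z h0 hzA hzB hzZ, hH, map_add, map_mul, hzA, hzB]
          simp)
      obtain ⟨U, W, hU, hW, rfl⟩ := (hom_coeffs h.hA h.hB hph hmem).2 (by omega)
      rw [show f + (e + f) + e - (e + f) = 0 + (e + f) by omega] at hU hW
      exact ⟨(⟨U, hU⟩, ⟨W, hW⟩), rfl⟩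
    have := Submodule.finrank_mono hle
    rw [← (Submodule.equivMapOfInjective V.subtype V.subtype_injective (LinearMap.ker E)).finrank_eq] at this
    exact this
  have e0 := choose_two_eq 0
  have e1 := choose_two_eq f
  have e2 := choose_two_eq (f + (e + f))
  have e3 := choose_two_eq (f + e)
  have e4 := choose_two_eq (0 + (e + f))
  rw [show e + f - e = f by omega]
  have e5 : f + e = 0 + (e + f) := by ring
  rw [e5] at e3 h1
  nlinarith

end

section

noncomputable def dd (s : Finset ℂ) (a : ℂ) : ℂ := ∏ j ∈ s.erase a, (a - j)

lemma dd_ne (s : Finset ℂ) (a : ℂ) : dd s a ≠ 0 := by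
  refine Finset.prod_ne_zero_iff.mpr fun j hj => ?_
  exact sub_ne_zero.mpr (Finset.ne_of_mem_erase hj).symm

lemma sum_pow_dd (s : Finset ℂ) (n : ℕ) (hn : n + 1 < s.card) : ∑ a ∈ s, a ^ n / dd s a = 0 := by
  have h := Lagrange.coeff_eq_sum (s := s) (v := fun x : ℂ => x) (fun _ _ _ _ h => h)
    (P := (Polynomial.X : Polynomial ℂ) ^ n) (by
      rw [Polynomial.degree_X_pow]; exact_mod_cast (by omega))
  rw [Polynomial.coeff_X_pow, if_neg (by omega)] at h
  simp only [Polynomial.eval_pow, Polynomial.eval_X] at h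
  exact h.symm

lemma grid_sum (s t : Finset ℂ) (Q : MvPolynomial (Fin 3) ℂ)
    (hQ : Q.totalDegree + 3 ≤ s.card + t.card) :
    ∑ a ∈ s, ∑ b ∈ t, eval ![1, a, b] Q / (dd s a * dd t b) = 0 := by
  have h1 : ∀ a b, eval ![1, a, b] Q = ∑ d ∈ Q.support, Q.coeff d * (a ^ d 1 * b ^ d 2) := by
    intro a b
    rw [eval_eq']
    refine Finset.sum_congr rfl fun d _ => ?_
    rw [Fin.prod_univ_three]
    simp
  simp_rw [h1, Finset.sum_div]
  have h2 : ∑ a ∈ s, ∑ b ∈ t, ∑ d ∈ Q.support, Q.coeff d * (a ^ d 1 * b ^ d 2) / (dd s a * dd t b)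
      = ∑ d ∈ Q.support, Q.coeff d * ((∑ a ∈ s, a ^ d 1 / dd s a) * (∑ b ∈ t, b ^ d 2 / dd t b)) := by
    simp_rw [Finset.sum_mul_sum, Finset.mul_sum]
    conv_rhs => rw [Finset.sum_comm]
    refine Finset.sum_congr rfl fun a _ => ?_
    conv_rhs => rw [Finset.sum_comm]
    refine Finset.sum_congr rfl fun b _ => Finset.sum_congr rfl fun d _ => ?_
    ring
  rw [h2]
  refine Finset.sum_eq_zero fun d hd => ?_
  have h3 : d 1 + d 2 ≤ Q.totalDegree := by
    have := le_totalDegree hd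
    rw [Finsupp.sum_fintype _ _ (by simp), Fin.sum_univ_three] at this
    omega
  by_cases h4 : d 1 + 1 < s.card
  · rw [sum_pow_dd s _ h4]; simp
  · rw [sum_pow_dd t (d 2) (by omega)]; simp

lemma pderiv_prod_at (i : Fin 3) (s : Finset ℂ) (c : Fin 3 → ℂ) (h0 : c 0 = 1) (hc : c i ∈ s) (j : Fin 3) (hj : j ≠ 0) :
    eval c (pderiv j (∏ a ∈ s, (X i - C a * X 0 : MvPolynomial (Fin 3) ℂ))) = if i = j then dd s (c i) else 0 := by
  rw [← Finset.mul_prod_erase _ _ hc, Derivation.leibniz]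
  simp only [smul_eq_mul, map_add, map_mul, map_sub, eval_X, eval_C, h0, mul_one, sub_self, zero_mul, zero_add, pderiv_C, Derivation.leibniz, eval_prod]
  rw [pderiv_X_of_ne hj.symm]
  by_cases h : i = j
  · subst h
    simp [dd]
  · rw [pderiv_X_of_ne h]
    simp [h]

lemma hprod_hom (i : Fin 3) (s : Finset ℂ) : (∏ a ∈ s, (X i - C a * X 0 : MvPolynomial (Fin 3) ℂ)).IsHomogeneous s.card := by
  have := IsHomogeneous.prod s (fun a => (X i - C a * X 0 : MvPolynomial (Fin 3) ℂ)) (fun _ => 1) (by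
    intro a _
    apply IsHomogeneous.sub (isHomogeneous_X _ _)
    have := (isHomogeneous_C (Fin 3) a).mul (isHomogeneous_X ℂ (0 : Fin 3))
    simpa using this)
  simpa using this

lemma hprod_ne (i : Fin 3) (hi : i ≠ 0) (s : Finset ℂ) : (∏ a ∈ s, (X i - C a * X 0 : MvPolynomial (Fin 3) ℂ)) ≠ 0 := by
  refine Finset.prod_ne_zero_iff.mpr fun a _ h => ?_
  have := congrArg (eval (Pi.single i 1 : Fin 3 → ℂ)) h
  simp [hi.symm] at this

lemma hprod_eval (i : Fin 3) (s : Finset ℂ) (c : Fin 3 → ℂ) (h0 : c 0 = 1) (hc : c i ∈ s) :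
    eval c (∏ a ∈ s, (X i - C a * X 0 : MvPolynomial (Fin 3) ℂ)) = 0 := by
  rw [eval_prod]
  exact Finset.prod_eq_zero hc (by simp [h0])

theorem GP.euler_jacobi {m : ℕ} {A B : MvPolynomial (Fin 3) ℂ} (h : GP m A B)
    (𝒳 : Finset (Fin 3 → ℂ)) (h𝒳 : ∀ z, z ∈ 𝒳 ↔ (z 0 = 1 ∧ eval z A = 0 ∧ eval z B = 0))
    {n : ℕ} (hn : n + 3 ≤ 2 * m) {G : MvPolynomial (Fin 3) ℂ} (hG : G.IsHomogeneous n) :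
    ∑ c ∈ 𝒳, eval c G / eval c (pderiv 1 A * pderiv 2 B - pderiv 2 A * pderiv 1 B) = 0 := by
  classical
  set s := 𝒳.image (fun c => c 1) with hs
  set t := 𝒳.image (fun c => c 2) with ht
  set H1 := ∏ a ∈ s, (X 1 - C a * X 0 : MvPolynomial (Fin 3) ℂ) with hH1
  set H2 := ∏ a ∈ t, (X 2 - C a * X 0 : MvPolynomial (Fin 3) ℂ) with hH2
  have m1 : ∀ c ∈ 𝒳, c 1 ∈ s := fun c hc => Finset.mem_image_of_mem _ hc
  have m2 : ∀ c ∈ 𝒳, c 2 ∈ t := fun c hc => Finset.mem_image_of_mem _ hc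
  have k1 := hom_coeffs h.hA h.hB (hprod_hom 1 s) (h.mem (hprod_hom 1 s) (fun z h0 hA hB =>
    hprod_eval 1 s z h0 (m1 z ((h𝒳 z).2 ⟨h0, hA, hB⟩))))
  have k2 := hom_coeffs h.hA h.hB (hprod_hom 2 t) (h.mem (hprod_hom 2 t) (fun z h0 hA hB =>
    hprod_eval 2 t z h0 (m2 z ((h𝒳 z).2 ⟨h0, hA, hB⟩))))
  have l1 : m ≤ s.card := by
    by_contra hlt
    exact hprod_ne 1 (by decide) s (k1.1 (by omega))
  have l2 : m ≤ t.card := by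
    by_contra hlt
    exact hprod_ne 2 (by decide) t (k2.1 (by omega))
  obtain ⟨U1, V1, hU1, hV1, e1⟩ := k1.2 l1
  obtain ⟨U2, V2, hU2, hV2, e2⟩ := k2.2 l2
  set M := U1 * V2 - V1 * U2 with hM
  have hMh : M.IsHomogeneous ((s.card - m) + (t.card - m)) := (hU1.mul hV2).sub (hV1.mul hU2)
  have hGM := hG.mul hMh
  have hgs := grid_sum s t (G * M) (by
    have := hGM.totalDegree_le
    omega)
  have key : ∀ c ∈ 𝒳, dd s (c 1) * dd t (c 2) = eval c M * eval c (pderiv 1 A * pderiv 2 B - pderiv 2 A * pderiv 1 B) := by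
    intro c hc
    obtain ⟨h0, hA, hB⟩ := (h𝒳 c).1 hc
    have a1 := pderiv_prod_at 1 s c h0 (m1 c hc) 1 (by decide)
    have a2 := pderiv_prod_at 1 s c h0 (m1 c hc) 2 (by decide)
    have a3 := pderiv_prod_at 2 t c h0 (m2 c hc) 1 (by decide)
    have a4 := pderiv_prod_at 2 t c h0 (m2 c hc) 2 (by decide)
    rw [e1] at a1 a2
    rw [e2] at a3 a4
    simp only [map_add, Derivation.leibniz, smul_eq_mul, map_mul, hA, hB, zero_mul, add_zero] at a1 a2 a3 a4
    rw [if_pos trivial] at a1 a4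
    rw [if_neg (by decide)] at a2 a3
    rw [← a1, ← a4]
    simp only [hM, map_sub, map_mul]
    linear_combination (eval c U2 * eval c (pderiv 1 A) + eval c V2 * eval c (pderiv 1 B)) * a2
  rw [← Finset.sum_product'] at hgs
  rw [← hgs]
  have himg : 𝒳.image (fun c => (c 1, c 2)) ⊆ s ×ˢ t := by
    intro p hp
    obtain ⟨c, hc, rfl⟩ := Finset.mem_image.mp hp
    exact Finset.mem_product.mpr ⟨m1 c hc, m2 c hc⟩
  have hvec : ∀ c : Fin 3 → ℂ, c 0 = 1 → ![1, c 1, c 2] = c := by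
    intro c h0
    ext i; fin_cases i <;> simp [h0]
  rw [← Finset.sum_subset himg]
  · rw [Finset.sum_image]
    · refine Finset.sum_congr rfl fun c hc => ?_
      obtain ⟨h0, hA, hB⟩ := (h𝒳 c).1 hc
      have hJ := h.jac c h0 hA hB
      simp only
      rw [hvec c h0, key c hc, map_mul]
      have hMne : eval c M ≠ 0 := by
        intro h0
        have := key c hc
        rw [h0, zero_mul] at this
        exact mul_ne_zero (dd_ne _ _) (dd_ne _ _) this
      field_simp
    · intro c hc c' hc' he
      have h1 := ((h𝒳 c).1 hc).1
      have h2 := ((h𝒳 c').1 hc').1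
      rw [← hvec c h1, ← hvec c' h2]
      simp only [Prod.mk.injEq] at he
      rw [he.1, he.2]
  · rintro ⟨a, b⟩ hab hni
    obtain ⟨ha, hb⟩ := Finset.mem_product.mp hab
    simp only
    set z : Fin 3 → ℂ := ![1, a, b] with hz
    have f1 := hprod_eval 1 s z (by simp [hz]) (by simpa [hz] using ha)
    have f2 := hprod_eval 2 t z (by simp [hz]) (by simpa [hz] using hb)
    rw [e1] at f1
    rw [e2] at f2
    simp only [map_add, map_mul] at f1 f2
    have : eval z M = 0 := by
      by_contra hne
      apply hni
      refine Finset.mem_image.mpr ⟨z, (h𝒳 z).2 ⟨by simp [hz], ?_, ?_⟩, by simp [hz]⟩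
      · have : eval z M * eval z A = 0 := by
          simp only [hM, map_sub, map_mul]
          linear_combination eval z V2 * f1 - eval z V1 * f2
        exact (mul_eq_zero.mp this).resolve_left hne
      · have : eval z M * eval z B = 0 := by
          simp only [hM, map_sub, map_mul]
          linear_combination eval z U1 * f2 - eval z U2 * f1
        exact (mul_eq_zero.mp this).resolve_left hne
    rw [map_mul, this, mul_zero, zero_div]

end

section

/-- chain rule for derivations -/
lemma deriv_aeval {K A : Type} [Field K] [CommRing A] [Algebra K A] (D : Derivation K A A) {n : ℕ}
    (f : Fin n → A) (p : MvPolynomial (Fin n) K) :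
    D (aeval f p) = ∑ i, aeval f (pderiv i p) * D (f i) := by
  induction p using MvPolynomial.induction_on with
  | C a => simp
  | add p q hp hq =>
    simp only [map_add, hp, hq, add_mul, Finset.sum_add_distrib]
  | mul_X p j hp =>
    have e : ∀ i, aeval f (pderiv i (p * X j)) * D (f i) =
      aeval f p * (if i = j then D (f i) else 0) + f j * (aeval f (pderiv i p) * D (f i)) := by
      intro i
      rw [Derivation.leibniz]
      by_cases h : i = j
      · subst h; simp; ring
      · rw [pderiv_X_of_ne (Ne.symm h)]; simp [h]; ring
    simp only [e, Finset.sum_add_distrib, ← Finset.mul_sum, ← hp]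
    simp [Derivation.leibniz]

lemma poly_second (g : Polynomial ℝ) (h0 : g.eval 0 = 0) (hg : ∀ t, 0 ≤ g.eval t) :
    g.derivative.eval 0 = 0 ∧ 0 ≤ g.derivative.derivative.eval 0 := by
  obtain ⟨h, rfl⟩ := Polynomial.X_dvd_iff.mpr (show g.coeff 0 = 0 by rwa [Polynomial.coeff_zero_eq_eval_zero])
  have hc : Continuous fun t => h.eval t := h.continuous
  have h1 : h.eval 0 = 0 := by
    apply le_antisymm
    · by_contra hlt
      push Not at hlt
      have := hc.continuousAt.eventually (lt_mem_nhds hlt)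
      obtain ⟨e, he, hb⟩ := Metric.eventually_nhds_iff.mp this
      have h2 := hb (y := -(e/2)) (by rw [Real.dist_eq, sub_zero, abs_neg, abs_of_pos] <;> linarith)
      have h3 := hg (-(e/2))
      simp only [Polynomial.eval_mul, Polynomial.eval_X] at h3
      nlinarith
    · by_contra hlt
      push Not at hlt
      have := hc.continuousAt.eventually (gt_mem_nhds hlt)
      obtain ⟨e, he, hb⟩ := Metric.eventually_nhds_iff.mp this
      have h2 := hb (y := (e/2)) (by rw [Real.dist_eq, sub_zero, abs_of_pos] <;> linarith)
      have h3 := hg (e/2)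
      simp only [Polynomial.eval_mul, Polynomial.eval_X] at h3
      nlinarith
  refine ⟨by simp [h1], ?_⟩
  obtain ⟨r, rfl⟩ := Polynomial.X_dvd_iff.mpr (show h.coeff 0 = 0 by rwa [Polynomial.coeff_zero_eq_eval_zero])
  have hcr : Continuous fun t => r.eval t := r.continuous
  have h2 : 0 ≤ r.eval 0 := by
    by_contra hlt
    push Not at hlt
    have := hcr.continuousAt.eventually (gt_mem_nhds hlt)
    obtain ⟨e, he, hb⟩ := Metric.eventually_nhds_iff.mp this
    have h2 := hb (y := (e/2)) (by rw [Real.dist_eq, sub_zero, abs_of_pos] <;> linarith)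
    have h3 := hg (e/2)
    simp only [Polynomial.eval_mul, Polynomial.eval_X] at h3
    have : 0 < e/2 * (e/2) := by positivity
    nlinarith
  simp
  linarith

noncomputable def ln (x v : Fin 3 → ℝ) : Fin 3 → Polynomial ℝ := fun i => Polynomial.C (x i) + Polynomial.C (v i) * Polynomial.X

lemma ln_eval (x v : Fin 3 → ℝ) (t : ℝ) (P : MvPolynomial (Fin 3) ℝ) :
    (aeval (ln x v) P).eval t = eval (x + t • v) P := by
  induction P using MvPolynomial.induction_on with
  | C a => simp
  | add p q hp hq => simp only [map_add, Polynomial.eval_add, hp, hq]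
  | mul_X p j hp =>
    simp only [map_mul, Polynomial.eval_mul, hp, aeval_X, eval_X]
    simp [ln, mul_comm t]

lemma ln_deriv (x v : Fin 3 → ℝ) (P : MvPolynomial (Fin 3) ℝ) :
    (aeval (ln x v) P).derivative = aeval (ln x v) (∑ i, C (v i) * pderiv i P) := by
  have := deriv_aeval (Polynomial.derivative' (R := ℝ)) (ln x v) P
  simp only [Polynomial.derivative'_apply] at this
  rw [this, map_sum]
  refine Finset.sum_congr rfl fun i _ => ?_
  rw [map_mul, mul_comm]
  congr 1
  simp [ln]

lemma psd_second (P : MvPolynomial (Fin 3) ℝ) (hpos : ∀ x, 0 ≤ eval x P) (x : Fin 3 → ℝ) (hx : eval x P = 0)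
    (v : Fin 3 → ℝ) : (∑ i, v i * eval x (pderiv i P) = 0) ∧
      0 ≤ ∑ i, ∑ j, v i * (v j * eval x (pderiv i (pderiv j P))) := by
  have h := poly_second (aeval (ln x v) P) (by rw [ln_eval]; simpa using hx) (fun t => by rw [ln_eval]; exact hpos _)
  rw [ln_deriv, ln_deriv, ln_eval, ln_eval] at h
  simpa [Finset.mul_sum] using h

lemma psd_grad (P : MvPolynomial (Fin 3) ℝ) (hpos : ∀ x, 0 ≤ eval x P) (x : Fin 3 → ℝ) (hx : eval x P = 0) (i : Fin 3) :
    eval x (pderiv i P) = 0 := by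
  have := (psd_second P hpos x hx (Pi.single i 1)).1
  simpa [Pi.single_apply] using this

lemma pderiv_comm' {K : Type} [Field K] (i j : Fin 3) (P : MvPolynomial (Fin 3) K) : pderiv i (pderiv j P) = pderiv j (pderiv i P) := by
  induction P using MvPolynomial.induction_on' with
  | add p q hp hq => simp [hp, hq]
  | monomial u a => 
    simp only [pderiv_monomial]
    by_cases h : i = j
    · rw [h]
    · simp [Finsupp.single_apply, h, Ne.symm h, mul_right_comm, tsub_right_comm]

lemma psd_jac (P : MvPolynomial (Fin 3) ℝ) (hpos : ∀ x, 0 ≤ eval x P) (x : Fin 3 → ℝ) (hx : eval x P = 0) :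
    0 ≤ eval x (pderiv 1 (pderiv 1 P) * pderiv 2 (pderiv 2 P) - pderiv 2 (pderiv 1 P) * pderiv 1 (pderiv 2 P)) := by
  have h : ∀ s t : ℝ, 0 ≤ eval x (pderiv 1 (pderiv 1 P)) * s * s + 2 * eval x (pderiv 1 (pderiv 2 P)) * t * s + eval x (pderiv 2 (pderiv 2 P)) * t * t := by
    intro s t
    have := (psd_second P hpos x hx ![0, s, t]).2
    simp only [Fin.sum_univ_three] at this
    simp at this
    rw [pderiv_comm' 2 1] at this
    nlinarith
  rw [pderiv_comm' 2 1]
  simp only [map_sub, map_mul]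
  have hq : ∀ s : ℝ, 0 ≤ eval x (pderiv 1 (pderiv 1 P)) * (s * s) + 2 * eval x (pderiv 1 (pderiv 2 P)) * s + eval x (pderiv 2 (pderiv 2 P)) := by
    intro s
    have := h s 1
    nlinarith
  have := discrim_le_zero hq
  rw [discrim] at this
  nlinarith

/-- conjugate the coefficients -/
noncomputable abbrev cj (p : MvPolynomial (Fin 3) ℂ) : MvPolynomial (Fin 3) ℂ := map (starRingEnd ℂ) p

def cjv (z : Fin 3 → ℂ) : Fin 3 → ℂ := fun i => (starRingEnd ℂ) (z i)

lemma cjv_cjv (z) : cjv (cjv z) = z := by ext i; simp [cjv]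

lemma cj_eval (z : Fin 3 → ℂ) (p : MvPolynomial (Fin 3) ℂ) : (starRingEnd ℂ) (eval z p) = eval (cjv z) (cj p) := by
  induction p using MvPolynomial.induction_on with
  | C a => simp
  | add p q hp hq => simp_all [cj]
  | mul_X p j hp => simp_all [cj, cjv]

noncomputable abbrev rc (p : MvPolynomial (Fin 3) ℝ) : MvPolynomial (Fin 3) ℂ := map (algebraMap ℝ ℂ) p

lemma cj_rc (p) : cj (rc p) = rc p := by
  rw [cj, rc, map_map]
  have : (starRingEnd ℂ).comp (algebraMap ℝ ℂ) = algebraMap ℝ ℂ := by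
    ext x; simp
  rw [this]

lemma rc_conj (z : Fin 3 → ℂ) (p) : eval (cjv z) (rc p) = (starRingEnd ℂ) (eval z (rc p)) := by
  rw [cj_eval, cj_rc]

lemma rc_real (x : Fin 3 → ℝ) (p) : eval (fun i => (x i : ℂ)) (rc p) = ((eval x p : ℝ) : ℂ) := by
  induction p using MvPolynomial.induction_on with
  | C a => simp
  | add p q hp hq => simp_all [rc]
  | mul_X p j hp => simp_all [rc]

lemma real_pt (z : Fin 3 → ℂ) (h : cjv z = z) : z = fun i => (((z i).re : ℝ) : ℂ) := by
  ext i
  have := congrFun h i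
  exact (Complex.conj_eq_iff_re.mp this).symm

/-- half systems for an involution -/
lemma half_system {X : Type} [Fintype X] [DecidableEq X] (τ : X → X) (hτ : ∀ c, τ (τ c) = c) :
    ∃ S : Finset X, (∀ c, τ c ≠ c → c ∈ S ∨ τ c ∈ S) ∧ ∀ p : X → Prop, ∀ [DecidablePred p], (∀ c, p c → p (τ c)) →
      (Finset.univ.filter fun c => p c).card = (Finset.univ.filter fun c => τ c = c ∧ p c).card
        + 2 * (S.filter fun c => p c).card := by
  classical
  let e := Fintype.equivFin X
  refine ⟨Finset.univ.filter fun c => e c < e (τ c), ?_, ?_⟩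
  · intro c hc
    simp only [Finset.mem_filter, Finset.mem_univ, true_and, hτ]
    rcases lt_trichotomy (e c) (e (τ c)) with h | h | h
    · exact Or.inl h
    · exact absurd (e.injective h).symm hc
    · exact Or.inr h
  · intro p _ hp
    have h1 : (Finset.univ.filter fun c => p c) = (Finset.univ.filter fun c => τ c = c ∧ p c) ∪
        (((Finset.univ.filter fun c => e c < e (τ c)).filter fun c => p c) ∪
         ((Finset.univ.filter fun c => e c < e (τ c)).filter fun c => p c).image τ) := by
      ext c
      simp only [Finset.mem_filter, Finset.mem_univ, true_and, Finset.mem_union, Finset.mem_image]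
      constructor
      · intro hc
        rcases lt_trichotomy (e c) (e (τ c)) with h | h | h
        · exact Or.inr (Or.inl ⟨h, hc⟩)
        · exact Or.inl ⟨(e.injective h).symm, hc⟩
        · exact Or.inr (Or.inr ⟨τ c, ⟨by rwa [hτ], hp c hc⟩, hτ c⟩)
      · rintro (h | h | ⟨c', h, rfl⟩)
        · exact h.2
        · exact h.2
        · exact hp _ h.2
    rw [h1, Finset.card_union_of_disjoint, Finset.card_union_of_disjoint, Finset.card_image_of_injective]
    · ring
    · intro a b hab
      rw [← hτ a, ← hτ b]
      exact congrArg τ hab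
    · rw [Finset.disjoint_left]
      intro c hc hc'
      simp only [Finset.mem_filter, Finset.mem_univ, true_and, Finset.mem_image] at hc hc'
      obtain ⟨c', h, rfl⟩ := hc'
      rw [hτ] at hc
      exact lt_asymm h.1 hc.1
    · rw [Finset.disjoint_left]
      intro c hc hc'
      simp only [Finset.mem_filter, Finset.mem_univ, true_and, Finset.mem_image, Finset.mem_union] at hc hc'
      rcases hc' with h | ⟨c', h, rfl⟩
      · rw [hc.1] at h; exact lt_irrefl _ h.1
      · rw [hτ] at hc
        rw [← hc.1] at h
        exact lt_irrefl _ h.1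

end

section

lemma sos_factor (n : ℕ) : ∀ f : Polynomial ℝ, f.natDegree ≤ 2 * n → (∀ t, 0 < f.eval t) →
    ∃ q : Polynomial ℂ, q.natDegree ≤ n ∧ f.map (algebraMap ℝ ℂ) = q * q.map (starRingEnd ℂ) := by
  have hconst : ∀ f : Polynomial ℝ, f.natDegree = 0 → (∀ t, 0 < f.eval t) →
    ∃ q : Polynomial ℂ, q.natDegree = 0 ∧ f.map (algebraMap ℝ ℂ) = q * q.map (starRingEnd ℂ) := by
    intro f hf hpos
    obtain ⟨c, rfl⟩ := Polynomial.natDegree_eq_zero.mp hf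
    refine ⟨Polynomial.C ((Real.sqrt c : ℝ) : ℂ), by simp, ?_⟩
    have := hpos 0
    simp only [Polynomial.eval_C] at this
    rw [Polynomial.map_C, Polynomial.map_C, ← Polynomial.C_mul, Complex.conj_ofReal, ← Complex.ofReal_mul,
      Real.mul_self_sqrt this.le]
    rfl
  induction n with
  | zero =>
    intro f hf hpos
    obtain ⟨q, h1, h2⟩ := hconst f (by omega) hpos
    exact ⟨q, by omega, h2⟩
  | succ n ih =>
    intro f hf hpos
    by_cases h0 : f.natDegree = 0
    · obtain ⟨q, h1, h2⟩ := hconst f h0 hpos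
      exact ⟨q, by omega, h2⟩
    obtain ⟨z, hz⟩ := IsAlgClosed.exists_aeval_eq_zero ℂ f (by
      intro h
      apply h0
      exact Polynomial.natDegree_eq_of_degree_eq_some h)
    have him : z.im ≠ 0 := by
      intro him
      have : z = ((z.re : ℝ) : ℂ) := by apply Complex.ext <;> simp [him]
      rw [this] at hz
      have h2 : Polynomial.aeval ((z.re : ℝ) : ℂ) f = ((f.eval z.re : ℝ) : ℂ) := by
        exact Polynomial.aeval_algebraMap_apply_eq_algebraMap_eval z.re f
      rw [h2] at hz
      exact (hpos z.re).ne' (by exact_mod_cast hz)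
    obtain ⟨g, rfl⟩ := f.quadratic_dvd_of_aeval_eq_zero_im_ne_zero hz him
    have hqm : ((Polynomial.X ^ 2 - Polynomial.C (2 * z.re) * Polynomial.X + Polynomial.C (‖z‖ ^ 2) : Polynomial ℝ).map (algebraMap ℝ ℂ))
       = (Polynomial.X - Polynomial.C z) * (Polynomial.X - Polynomial.C ((starRingEnd ℂ) z)) := by
      have e1 : ((2 * z.re : ℝ) : ℂ) = z + (starRingEnd ℂ) z := by rw [Complex.add_conj]
      have e2 : ((‖z‖ ^ 2 : ℝ) : ℂ) = z * (starRingEnd ℂ) z := by rw [Complex.mul_conj']; push_cast; rfl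
      simp only [Polynomial.map_add, Polynomial.map_sub, Polynomial.map_mul, Polynomial.map_pow, Polynomial.map_X, Polynomial.map_C, Complex.coe_algebraMap]
      rw [e1, e2]
      simp only [map_add, map_mul]
      ring
    have hqpos : ∀ t : ℝ, 0 < (Polynomial.X ^ 2 - Polynomial.C (2 * z.re) * Polynomial.X + Polynomial.C (‖z‖ ^ 2) : Polynomial ℝ).eval t := by
      intro t
      simp only [Polynomial.eval_add, Polynomial.eval_sub, Polynomial.eval_mul, Polynomial.eval_pow, Polynomial.eval_X, Polynomial.eval_C]
      rw [Complex.sq_norm, Complex.normSq_apply]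
      have : 0 < z.im * z.im := mul_self_pos.mpr him
      nlinarith [sq_nonneg (t - z.re)]
    have hg0 : g ≠ 0 := by
      rintro rfl
      simp at h0
    have hgpos : ∀ t, 0 < g.eval t := by
      intro t
      have := hpos t
      rw [Polynomial.eval_mul] at this
      exact (mul_pos_iff_of_pos_left (hqpos t)).mp this
    have hdeg : (Polynomial.X ^ 2 - Polynomial.C (2 * z.re) * Polynomial.X + Polynomial.C (‖z‖ ^ 2) : Polynomial ℝ).natDegree = 2 := by
      compute_degree!
    have hgd : g.natDegree ≤ 2 * n := by
      rw [Polynomial.natDegree_mul (by intro h; rw [h] at hdeg; simp at hdeg) hg0, hdeg] at hf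
      omega
    obtain ⟨q, h1, h2⟩ := ih g hgd hgpos
    refine ⟨(Polynomial.X - Polynomial.C z) * q, ?_, ?_⟩
    · refine Polynomial.natDegree_mul_le.trans ?_
      rw [Polynomial.natDegree_X_sub_C]
      omega
    · rw [Polynomial.map_mul, hqm, h2]
      simp only [Polynomial.map_mul, Polynomial.map_sub, Polynomial.map_X, Polynomial.map_C]
      ring

/-- binary forms of degree n in x1, x2 -/
noncomputable def bin (n : ℕ) : (Fin (n + 1) → ℂ) →ₗ[ℂ] MvPolynomial (Fin 3) ℂ where
  toFun a := ∑ i, C (a i) * (X 1 ^ (n - i.1) * X 2 ^ i.1)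
  map_add' a b := by simp [add_mul, Finset.sum_add_distrib]
  map_smul' r a := by simp [smul_eq_C_mul, Finset.mul_sum, mul_assoc]

lemma bin_apply (n : ℕ) (a : Fin (n + 1) → ℂ) : bin n a = ∑ i, C (a i) * (X 1 ^ (n - i.1) * X 2 ^ i.1) := rfl

lemma bin_hom (n : ℕ) (a : Fin (n + 1) → ℂ) : (bin n a).IsHomogeneous n := by
  rw [bin_apply]
  apply IsHomogeneous.sum
  intro i _
  have h1 := (isHomogeneous_X_pow (R := ℂ) (1 : Fin 3) (n - i.1)).mul (isHomogeneous_X_pow (2 : Fin 3) i.1)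
  have h2 := (isHomogeneous_C (Fin 3) (a i)).mul h1
  have e : 0 + (n - i.1 + i.1) = n := by omega
  rwa [e] at h2

lemma bin_pi0 (n : ℕ) (a : Fin (n + 1) → ℂ) : pi0 (bin n a) = bin n a := by
  rw [bin_apply, map_sum]
  refine Finset.sum_congr rfl fun i _ => ?_
  simp [pi0, algebraMap_eq]

lemma bin_eval (n : ℕ) (a : Fin (n + 1) → ℂ) (z : Fin 3 → ℂ) (hz : z 1 ≠ 0) :
    eval z (bin n a) = z 1 ^ n * ∑ i, a i * (z 2 / z 1) ^ i.1 := by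
  rw [bin_apply, map_sum, Finset.mul_sum]
  refine Finset.sum_congr rfl fun i _ => ?_
  simp only [map_mul, map_pow, eval_C, eval_X]
  have : z 1 ^ n = z 1 ^ (n - i.1) * z 1 ^ i.1 := by rw [← pow_add]; congr 1; omega
  rw [this, div_pow]
  field_simp

lemma bin_inj (n : ℕ) (a : Fin (n + 1) → ℂ) (h : bin n a = 0) : a = 0 := by
  have h1 : (∑ i : Fin (n + 1), Polynomial.C (a i) * Polynomial.X ^ i.1 : Polynomial ℂ) = 0 := by
    apply Polynomial.funext
    intro t
    have := bin_eval n a ![0, 1, t] (by simp)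
    rw [h] at this
    simp at this
    simp [Polynomial.eval_finsetSum, ← this]
  ext i
  have := congrArg (fun p => Polynomial.coeff p i.1) h1
  simp only [Polynomial.finsetSum_coeff, Polynomial.coeff_C_mul, Polynomial.coeff_X_pow, Polynomial.coeff_zero] at this
  rw [Finset.sum_eq_single i] at this
  · simpa using this
  · intro j _ hj
    rw [if_neg (fun h => hj (Fin.ext h.symm))]; simp
  · simp

lemma bin_cj (n : ℕ) (a : Fin (n + 1) → ℂ) : cj (bin n a) = bin n (fun i => (starRingEnd ℂ) (a i)) := by
  simp [bin_apply, cj]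

lemma eq_of_eval_ne {p q : MvPolynomial (Fin 3) ℂ} (h : ∀ z : Fin 3 → ℂ, z 1 ≠ 0 → eval z p = eval z q) : p = q := by
  have h2 : X 1 * (p - q) = 0 := by
    apply MvPolynomial.funext
    intro z
    by_cases hz : z 1 = 0
    · simp [hz]
    · simp [h z hz]
  have := (mul_eq_zero.mp h2).resolve_left (X_ne_zero _)
  exact sub_eq_zero.mp this

theorem exists_L {k : ℕ} {P : MvPolynomial (Fin 3) ℝ} (hh : P.IsHomogeneous (2 * k))
    (hpos : ∀ x : Fin 3 → ℝ, x 0 = 0 → x 1 = 1 → 0 < eval x P) :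
    ∃ a : Fin (k + 1) → ℂ, pi0 (rc P) = bin k a * cj (bin k a) := by
  set f : Polynomial ℝ := aeval ![0, 1, Polynomial.X] P with hf
  have hfe : ∀ t : ℝ, f.eval t = eval ![0, 1, t] P := by
    intro t
    have := ln_eval ![0, 1, 0] ![0, 0, 1] t P
    have e1 : ln ![0, 1, 0] ![0, 0, 1] = ![0, 1, Polynomial.X] := by
      ext i; fin_cases i <;> simp [ln]
    have e2 : (![0, 1, 0] : Fin 3 → ℝ) + t • ![0, 0, 1] = ![0, 1, t] := by
      ext i; fin_cases i <;> simp
    rw [e1, e2] at this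
    exact this
  have hfd : f.natDegree ≤ 2 * k := by
    have := aeval_natDegree_le P hh.totalDegree_le (![0, 1, Polynomial.X] : Fin 3 → Polynomial ℝ) (n := 1) (by
      intro i; fin_cases i <;> simp)
    rw [mul_one] at this
    exact this
  obtain ⟨q, hq1, hq2⟩ := sos_factor k f hfd (fun t => by rw [hfe]; exact hpos _ (by simp) (by simp))
  refine ⟨fun i => q.coeff i.1, eq_of_eval_ne fun z hz => ?_⟩
  have hfc : ∀ t : ℂ, (f.map (algebraMap ℝ ℂ)).eval t = eval ![0, 1, t] (rc P) := by
    intro t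
    rw [hf]
    clear hq2 hfd hfe hf f hh hpos
    induction P using MvPolynomial.induction_on with
    | C a => simp
    | add p q hp hq => simp only [map_add, Polynomial.map_add, Polynomial.eval_add, hp, hq, rc]
    | mul_X p j hp =>
      simp only [map_mul, Polynomial.map_mul, Polynomial.eval_mul, hp, rc, aeval_X, map_X, eval_X]
      congr 1
      fin_cases j <;> simp
  have hqs : ∀ t : ℂ, q.eval t = ∑ i : Fin (k + 1), q.coeff i.1 * t ^ i.1 := by
    intro t
    rw [Polynomial.eval_eq_sum_range' (n := k + 1) (by omega), Finset.sum_range]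
  have hqs2 : ∀ t : ℂ, (q.map (starRingEnd ℂ)).eval t = ∑ i : Fin (k + 1), (starRingEnd ℂ) (q.coeff i.1) * t ^ i.1 := by
    intro t
    rw [Polynomial.eval_eq_sum_range' (n := k + 1) (by rw [Polynomial.natDegree_map]; omega), Finset.sum_range]
    simp
  rw [bin_cj, map_mul, bin_eval _ _ _ hz, bin_eval _ _ _ hz, ← hqs, ← hqs2, eval_pi0]
  have e3 : (fun i => if i = 0 then 0 else z i) = z 1 • ![0, 1, z 2 / z 1] := by
    ext i; fin_cases i
    · simp
    · simp
    · simp; field_simp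
  rw [e3, hom_smul (hh.map _), ← hfc, hq2, Polynomial.eval_mul]
  ring

end

section

lemma cj_hom {p : MvPolynomial (Fin 3) ℂ} {n : ℕ} (h : p.IsHomogeneous n) : (cj p).IsHomogeneous n := h.map _

lemma X0_hom : (X 0 : MvPolynomial (Fin 3) ℂ).IsHomogeneous 1 := isHomogeneous_X _ _

lemma hom_cast {p : MvPolynomial (Fin 3) ℂ} {n n' : ℕ} (h : p.IsHomogeneous n) (e : n = n') : p.IsHomogeneous n' := e ▸ h

lemma divX0_hom {q : MvPolynomial (Fin 3) ℂ} {n : ℕ} (h : (X 0 * q).IsHomogeneous (n + 1)) : q.IsHomogeneous n := by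
  rw [mul_comm] at h
  intro d hd
  have h1 : coeff (d + Finsupp.single 0 1) (q * X 0) ≠ 0 := by
    rw [coeff_mul_X]; exact hd
  have := h h1
  simp only [map_add] at this
  have e : Finsupp.weight (1 : Fin 3 → ℕ) (Finsupp.single 0 1) = 1 := by simp [Finsupp.weight_single]
  rw [e] at this
  exact Nat.add_right_cancel this

noncomputable abbrev JR (P : MvPolynomial (Fin 3) ℝ) : MvPolynomial (Fin 3) ℝ :=
  pderiv 1 (pderiv 1 P) * pderiv 2 (pderiv 2 P) - pderiv 2 (pderiv 1 P) * pderiv 1 (pderiv 2 P)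

lemma rc_JR (P : MvPolynomial (Fin 3) ℝ) : rc (JR P) = pderiv 1 (rc (pderiv 1 P)) * pderiv 2 (rc (pderiv 2 P)) -
    pderiv 2 (rc (pderiv 1 P)) * pderiv 1 (rc (pderiv 2 P)) := by
  simp only [rc, JR, map_sub, map_mul, pderiv_map]

lemma euler_rc {n : ℕ} {P : MvPolynomial (Fin 3) ℝ} (hh : P.IsHomogeneous n) :
    X 0 * rc (pderiv 0 P) + X 1 * rc (pderiv 1 P) + X 2 * rc (pderiv 2 P) = C (n : ℂ) * rc P := by
  have h := (hh.map (algebraMap ℝ ℂ)).sum_X_mul_pderiv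
  rw [Fin.sum_univ_three, pderiv_map, pderiv_map, pderiv_map] at h
  rw [rc, rc, rc, h]
  simp [rc]

variable {j : ℕ} {P : MvPolynomial (Fin 3) ℝ}

lemma iso_I (hh : P.IsHomogeneous (2 * (j + 2)))
    (hgp : GP (2 * j + 3) (rc (pderiv 1 P)) (rc (pderiv 2 P))) (𝒳 : Finset (Fin 3 → ℂ))
    (h𝒳 : ∀ z, z ∈ 𝒳 ↔ (z 0 = 1 ∧ eval z (rc (pderiv 1 P)) = 0 ∧ eval z (rc (pderiv 2 P)) = 0))
    {g : MvPolynomial (Fin 3) ℂ} (hg : g.IsHomogeneous j) :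
    ∑ c ∈ 𝒳, -(eval c (rc P)) / eval c (rc (JR P)) * (eval c (g * cj g)) = 0 := by
  have h0 : (rc (pderiv 0 P) * (g * cj g)).IsHomogeneous (2 * j + 3 + (j + j)) := by
    apply IsHomogeneous.mul
    · have := (hh.pderiv (i := 0)).map (algebraMap ℝ ℂ)
      exact hom_cast this (by omega)
    · exact hg.mul (cj_hom hg)
  have h1 := hgp.euler_jacobi 𝒳 h𝒳 (by omega) h0
  rw [← rc_JR] at h1
  have hd : ((2 * (j + 2) : ℕ) : ℂ) ≠ 0 := Nat.cast_ne_zero.mpr (by omega)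
  have e : ∀ c ∈ 𝒳, -(eval c (rc P)) / eval c (rc (JR P)) * (eval c (g * cj g)) =
     -(1 / ((2 * (j + 2) : ℕ) : ℂ)) * (eval c (rc (pderiv 0 P) * (g * cj g)) / eval c (rc (JR P))) := by
    intro c hc
    obtain ⟨a0, a1, a2⟩ := (h𝒳 c).1 hc
    have := congrArg (eval c) (euler_rc hh)
    simp only [map_add, map_mul, eval_X, eval_C, a0, a1, a2, mul_zero, add_zero, one_mul] at this
    rw [map_mul _ (rc (pderiv 0 P)), this]
    field_simp
  rw [Finset.sum_congr rfl e, ← Finset.mul_sum, h1, mul_zero]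

lemma iso_II (hh : P.IsHomogeneous (2 * (j + 2)))
    (hgp : GP (2 * j + 3) (rc (pderiv 1 P)) (rc (pderiv 2 P))) (𝒳 : Finset (Fin 3 → ℂ))
    (h𝒳 : ∀ z, z ∈ 𝒳 ↔ (z 0 = 1 ∧ eval z (rc (pderiv 1 P)) = 0 ∧ eval z (rc (pderiv 2 P)) = 0))
    {L : MvPolynomial (Fin 3) ℂ} (hL : L.IsHomogeneous (j + 2)) (hLP : pi0 (rc P) = L * cj L)
    {G w : MvPolynomial (Fin 3) ℂ} (hG : G.IsHomogeneous (2 * j + 1)) (hw : w.IsHomogeneous j) :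
    ∑ c ∈ 𝒳, 1 / eval c (rc (JR P)) * (eval c ((X 0 * G + L * w) * cj (X 0 * G + L * w))) = 0 := by
  have hd : ((2 * (j + 2) : ℕ) : ℂ) ≠ 0 := Nat.cast_ne_zero.mpr (by omega)
  have hU : (X 0 * G + L * w).IsHomogeneous (2 * j + 2) := by
    apply IsHomogeneous.add
    · exact hom_cast (X0_hom.mul hG) (by omega)
    · exact hom_cast (hL.mul hw) (by omega)
  have hLw := hL.mul hw
  have hH : (G * cj (X 0 * G + L * w) + L * w * cj G).IsHomogeneous (4 * j + 3) := by
    apply IsHomogeneous.add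
    · exact hom_cast (hG.mul (cj_hom hU)) (by omega)
    · exact hom_cast (hLw.mul (cj_hom hG)) (by omega)
  have hdec : (X 0 * G + L * w) * cj (X 0 * G + L * w) =
      X 0 * (G * cj (X 0 * G + L * w) + L * w * cj G) + pi0 (rc P) * (w * cj w) := by
    rw [hLP]
    simp only [cj, map_add, map_mul, map_X]
    ring
  obtain ⟨Q1, hQ1⟩ := X0_dvd_sub (rc (pderiv 1 P))
  obtain ⟨Q2, hQ2⟩ := X0_dvd_sub (rc (pderiv 2 P))
  have hQ1h : Q1.IsHomogeneous (2 * j + 2) := by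
    apply divX0_hom
    rw [← hQ1]
    exact hgp.hA.sub (pi0_hom hgp.hA)
  have hQ2h : Q2.IsHomogeneous (2 * j + 2) := by
    apply divX0_hom
    rw [← hQ2]
    exact hgp.hB.sub (pi0_hom hgp.hB)
  have hR : ((X 1 * Q1 + X 2 * Q2) * (w * cj w)).IsHomogeneous (4 * j + 3) := by
    have h1 : (X 1 * Q1 + X 2 * Q2).IsHomogeneous (1 + (2 * j + 2)) :=
      ((isHomogeneous_X _ _).mul hQ1h).add ((isHomogeneous_X _ _).mul hQ2h)
    exact hom_cast (h1.mul (hw.mul (cj_hom hw))) (by omega)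
  have s1 := hgp.euler_jacobi 𝒳 h𝒳 (by omega) hH
  have s2 := hgp.euler_jacobi 𝒳 h𝒳 (by omega) hR
  rw [← rc_JR] at s1 s2
  have heu := congrArg pi0 (euler_rc hh)
  have e : ∀ c ∈ 𝒳, 1 / eval c (rc (JR P)) * (eval c ((X 0 * G + L * w) * cj (X 0 * G + L * w))) =
     eval c (G * cj (X 0 * G + L * w) + L * w * cj G) / eval c (rc (JR P)) 
     - (1 / ((2 * (j + 2) : ℕ) : ℂ)) * (eval c ((X 1 * Q1 + X 2 * Q2) * (w * cj w)) / eval c (rc (JR P))) := by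
    intro c hc
    obtain ⟨a0, a1, a2⟩ := (h𝒳 c).1 hc
    have b1 := congrArg (eval c) hQ1
    have b2 := congrArg (eval c) hQ2
    have b3 := congrArg (eval c) heu
    have p1 : pi0 (X 1) = X 1 := by simp [pi0]
    have p2 : pi0 (X 2) = X 2 := by simp [pi0]
    have p3 : ∀ r : ℂ, pi0 (C r) = C r := fun r => by simp [pi0, algebraMap_eq]
    simp only [map_sub, map_add, map_mul, eval_X, eval_C, a0, a1, a2, pi0_X0, p1, p2, p3, zero_mul, zero_add, one_mul, zero_sub] at b1 b2 b3
    rw [hdec, map_add, map_mul _ (X 0), eval_X, a0, one_mul, map_mul _ (pi0 (rc P)), map_mul _ (X 1 * Q1 + X 2 * Q2)]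
    have b4 : eval c (pi0 (rc P)) = - (1 / ((2 * (j + 2) : ℕ) : ℂ)) * eval c (X 1 * Q1 + X 2 * Q2) := by
      simp only [map_add, map_mul, eval_X]
      rw [← b1, ← b2]
      field_simp
      linear_combination -b3
    rw [b4]
    ring
  rw [Finset.sum_congr rfl e, Finset.sum_sub_distrib, ← Finset.mul_sum, s1, s2, mul_zero, sub_zero]

lemma conj_eval_conj (c : Fin 3 → ℂ) (p) : (starRingEnd ℂ) (eval (cjv c) p) = eval c (cj p) := by
  rw [cj_eval, cjv_cjv]

theorem index_I (hh : P.IsHomogeneous (2 * (j + 2)))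
    (hgp : GP (2 * j + 3) (rc (pderiv 1 P)) (rc (pderiv 2 P))) (𝒳 : Finset (Fin 3 → ℂ))
    (h𝒳 : ∀ z, z ∈ 𝒳 ↔ (z 0 = 1 ∧ eval z (rc (pderiv 1 P)) = 0 ∧ eval z (rc (pderiv 2 P)) = 0))
    (hZc : (𝒳.filter fun z => eval z (rc P) = 0).card = (j + 1) * (2 * j + 3))
    (τ : 𝒳 → 𝒳) (hτ : ∀ c, (τ c).1 = cjv c.1) (S : Finset 𝒳) (hS2 : ∀ c, τ c ≠ c → c ∈ S ∨ τ c ∈ S) :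
    (j + 2).choose 2 ≤ (Finset.univ.filter fun c : 𝒳 => τ c = c ∧ (-(eval c.1 (rc P)) / eval c.1 (rc (JR P))).re < 0).card
     + (S.filter fun c => eval c.1 (rc P) ≠ 0).card := by
  have hJ : ∀ c : 𝒳, eval c.1 (rc (JR P)) ≠ 0 := by
    intro c
    obtain ⟨a0, a1, a2⟩ := (h𝒳 c).1 c.2
    rw [rc_JR]
    exact hgp.jac _ a0 a1 a2
  let ev : S3 j →ₗ[ℂ] (𝒳 → ℂ) := 
    { toFun := fun g c => eval c.1 g.1
      map_add' := by intro a b; ext c; simp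
      map_smul' := by intro a b; ext c; simp }
  have hev : ∀ u c, ev u c = eval c.1 u.1 := fun _ _ => rfl
  have hmain := herm_index τ (fun c => Subtype.ext (by rw [hτ, hτ, cjv_cjv]))
    (fun c => -(eval c.1 (rc P)) / eval c.1 (rc (JR P)))
    (by
      intro c
      simp only [hτ, rc_conj, map_div₀, map_neg])
    ev
    (by
      intro u hu
      by_contra hne
      have h1 := hgp.no_form (e := j) (by omega) (g := u.1) (fun h => hne (Subtype.ext h)) u.2
        (𝒳.filter fun z => eval z (rc P) = 0) (by
          intro z h0 hA hB hz
          have hz𝒳 := (h𝒳 z).2 ⟨h0, hA, hB⟩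
          refine hu ⟨z, hz𝒳⟩ ?_
          refine div_ne_zero (neg_ne_zero.mpr ?_) (hJ _)
          intro h
          exact hz (Finset.mem_filter.mpr ⟨hz𝒳, h⟩))
      rw [hZc, show 2 * j + 3 - j = j + 3 by omega] at h1
      nlinarith)
    (by
      intro u
      have h1 := iso_I hh hgp 𝒳 h𝒳 u.2
      rw [← Finset.sum_coe_sort] at h1
      rw [← h1]
      refine Finset.sum_congr rfl fun c _ => ?_
      rw [hev, hev, hτ, conj_eval_conj, map_mul _ u.1])
    S hS2
  rw [finrank_S3] at hmain
  refine hmain.trans (Nat.add_le_add_left ?_ _)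
  apply le_of_eq
  congr 1
  apply Finset.filter_congr
  intro c _
  simp only [ne_eq, div_eq_zero_iff, neg_eq_zero, hJ c, or_false]

theorem index_II (hh : P.IsHomogeneous (2 * (j + 2)))
    (hgp : GP (2 * j + 3) (rc (pderiv 1 P)) (rc (pderiv 2 P))) (𝒳 : Finset (Fin 3 → ℂ))
    (h𝒳 : ∀ z, z ∈ 𝒳 ↔ (z 0 = 1 ∧ eval z (rc (pderiv 1 P)) = 0 ∧ eval z (rc (pderiv 2 P)) = 0))
    (hpos : ∀ x, 0 ≤ eval x P)
    (τ : 𝒳 → 𝒳) (hτ : ∀ c, (τ c).1 = cjv c.1) (S : Finset 𝒳) (hS2 : ∀ c, τ c ≠ c → c ∈ S ∨ τ c ∈ S) :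
    (2 * j + 3).choose 2 + (j + 1) ≤ (Finset.univ.filter fun c : 𝒳 => τ c = c ∧ (1 / eval c.1 (rc (JR P))).re < 0).card
     + S.card := by
  have hJ : ∀ c : 𝒳, eval c.1 (rc (JR P)) ≠ 0 := by
    intro c
    obtain ⟨a0, a1, a2⟩ := (h𝒳 c).1 c.2
    rw [rc_JR]
    exact hgp.jac _ a0 a1 a2
  obtain ⟨l, hl⟩ := exists_L hh (by
    intro x h0 h1
    refine lt_of_le_of_ne (hpos x) fun h => ?_
    have e1 := psd_grad P hpos x h.symm 1
    have e2 := psd_grad P hpos x h.symm 2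
    have := hgp.inf (fun i => (x i : ℂ)) (by simp [h0]) (by rw [rc_real, e1]; simp) (by rw [rc_real, e2]; simp)
    have := congrFun this 1
    simp [h1] at this)
  have hlne : bin (j + 2) l ≠ 0 := by
    intro h
    rw [h, zero_mul] at hl
    obtain ⟨Q, hQ⟩ := pi0_dvd hl
    have hx : eval (![0, 1, 0] : Fin 3 → ℝ) P = 0 := by
      have := congrArg (eval (fun i => ((![0, 1, 0] : Fin 3 → ℝ) i : ℂ))) hQ
      rw [rc_real] at this
      simpa using this
    have e1 := psd_grad P hpos _ hx 1
    have e2 := psd_grad P hpos _ hx 2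
    have := hgp.inf (fun i => ((![0, 1, 0] : Fin 3 → ℝ) i : ℂ)) (by simp) (by rw [rc_real, e1]; simp) (by rw [rc_real, e2]; simp)
    have := congrFun this 1
    simp at this
  let ev : (S3 (2 * j + 1) × (Fin (j + 1) → ℂ)) →ₗ[ℂ] (𝒳 → ℂ) := 
    { toFun := fun g c => eval c.1 (X 0 * g.1.1 + bin (j + 2) l * bin j g.2)
      map_add' := by intro a b; ext c; simp; ring
      map_smul' := by intro a b; ext c; simp; ring }
  have hev : ∀ u c, ev u c = eval c.1 (X 0 * u.1.1 + bin (j + 2) l * bin j u.2) := fun _ _ => rfl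
  have hmain := herm_index τ (fun c => Subtype.ext (by rw [hτ, hτ, cjv_cjv]))
    (fun c => 1 / eval c.1 (rc (JR P)))
    (by
      intro c
      simp only [hτ, rc_conj, map_div₀, map_one])
    ev
    (by
      intro u hu
      have hU : (X 0 * u.1.1 + bin (j + 2) l * bin j u.2).IsHomogeneous (2 * j + 2) := by
        apply IsHomogeneous.add
        · exact hom_cast (X0_hom.mul u.1.2) (by omega)
        · exact hom_cast ((bin_hom _ _).mul (bin_hom _ _)) (by omega)
      have h1 : X 0 * u.1.1 + bin (j + 2) l * bin j u.2 = 0 := by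
        refine (hom_coeffs hgp.hA hgp.hB hU (hgp.mem hU ?_)).1 (by omega)
        intro z h0 hA hB
        exact hu ⟨z, (h𝒳 z).2 ⟨h0, hA, hB⟩⟩ (one_div_ne_zero (hJ _))
      have h2 := congrArg pi0 h1
      rw [map_add, map_mul, map_mul, pi0_X0, bin_pi0, bin_pi0, zero_mul, zero_add, map_zero] at h2
      have h3 := (mul_eq_zero.mp h2).resolve_left hlne
      rw [h3, mul_zero, add_zero] at h1
      have h4 := (mul_eq_zero.mp h1).resolve_left (X_ne_zero _)
      exact Prod.ext (Subtype.ext h4) (bin_inj _ _ h3))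
    (by
      intro u
      have h1 := iso_II hh hgp 𝒳 h𝒳 (bin_hom _ l) hl u.1.2 (bin_hom _ u.2)
      rw [← Finset.sum_coe_sort] at h1
      rw [← h1]
      refine Finset.sum_congr rfl fun c _ => ?_
      rw [hev, hev, hτ, conj_eval_conj, map_mul _ (X 0 * u.1.1 + bin (j + 2) l * bin j u.2)])
    S hS2
  rw [Module.finrank_prod, finrank_S3, Module.finrank_fin_fun] at hmain
  refine hmain.trans (Nat.add_le_add_left ?_ _)
  exact Finset.card_filter_le _ _

theorem core_pos (hh : P.IsHomogeneous (2 * (j + 2))) (hpos : ∀ x, 0 ≤ eval x P)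
    (hgp : GP (2 * j + 3) (rc (pderiv 1 P)) (rc (pderiv 2 P)))
    (Z : Finset (Fin 3 → ℂ)) (hZ : ∀ z, z ∈ Z ↔ (z 0 = 1 ∧ eval z (rc P) = 0 ∧
      eval z (rc (pderiv 1 P)) = 0 ∧ eval z (rc (pderiv 2 P)) = 0))
    (hZc : Z.card = (j + 1) * (2 * j + 3))
    (T : Finset (Fin 3 → ℝ)) (hT : ∀ x ∈ T, x 0 = 1 ∧ eval x P = 0) : T.card ≤ (j + 2) ^ 2 + 1 := by
  classical
  have hfin : {z : Fin 3 → ℂ | z 0 = 1 ∧ eval z (rc (pderiv 1 P)) = 0 ∧ eval z (rc (pderiv 2 P)) = 0}.Finite := by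
    by_contra hinf
    obtain ⟨t, ht, htc⟩ := Set.Infinite.exists_subset_card_eq hinf ((2 * j + 3) * (2 * j + 3) + 1)
    have := hgp.card_le t (fun z hz => ht hz)
    omega
  set 𝒳 := hfin.toFinset with h𝒳d
  have h𝒳 : ∀ z, z ∈ 𝒳 ↔ (z 0 = 1 ∧ eval z (rc (pderiv 1 P)) = 0 ∧ eval z (rc (pderiv 2 P)) = 0) := by
    intro z; simp [h𝒳d]
  have hN := hgp.card_le 𝒳 (fun z hz => (h𝒳 z).1 hz)
  have hZ𝒳 : (𝒳.filter fun z => eval z (rc P) = 0) = Z := by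
    ext z
    rw [Finset.mem_filter, h𝒳, hZ]
    tauto
  let τ : 𝒳 → 𝒳 := fun c => ⟨cjv c.1, by
    obtain ⟨a0, a1, a2⟩ := (h𝒳 c).1 c.2
    refine (h𝒳 _).2 ⟨by simp [cjv, a0], ?_, ?_⟩
    · rw [rc_conj, a1, map_zero]
    · rw [rc_conj, a2, map_zero]⟩
  have hτ : ∀ c, (τ c).1 = cjv c.1 := fun _ => rfl
  have hττ : ∀ c, τ (τ c) = c := fun c => Subtype.ext (by rw [hτ, hτ, cjv_cjv])
  have hJ : ∀ c : 𝒳, eval c.1 (rc (JR P)) ≠ 0 := by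
    intro c
    obtain ⟨a0, a1, a2⟩ := (h𝒳 c).1 c.2
    rw [rc_JR]
    exact hgp.jac _ a0 a1 a2
  obtain ⟨S, hS2, hSc⟩ := half_system τ hττ
  have i1 := index_I hh hgp 𝒳 h𝒳 (by rw [hZ𝒳, hZc]) τ hτ S hS2
  have i2 := index_II hh hgp 𝒳 h𝒳 hpos τ hτ S hS2
  have c1 := hSc (fun c => eval c.1 (rc P) = 0) (by
    intro c hc
    rw [hτ, rc_conj, hc, map_zero])
  have c2 := hSc (fun c => eval c.1 (rc P) ≠ 0) (by
    intro c hc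
    rw [hτ, rc_conj]
    simpa using hc)
  have f1 := Finset.card_filter_add_card_filter_not (s := (Finset.univ : Finset 𝒳)) (fun c => eval c.1 (rc P) = 0)
  have f2 := Finset.card_filter_add_card_filter_not (s := S) (fun c => eval c.1 (rc P) = 0)
  have f3 : (Finset.univ.filter fun c : 𝒳 => eval c.1 (rc P) = 0).card = (j + 1) * (2 * j + 3) := by
    rw [← hZc, ← hZ𝒳, ← Finset.card_map (Function.Embedding.subtype _)]
    congr 1
    ext z
    simp
    tauto
  have f4 : (Finset.univ : Finset 𝒳).card = 𝒳.card := by simp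
  have hreal : ∀ c : 𝒳, τ c = c → ∃ x : Fin 3 → ℝ, c.1 = fun i => (x i : ℂ) := by
    intro c hc
    exact ⟨_, real_pt c.1 (congrArg Subtype.val hc)⟩
  have g1 : (Finset.univ.filter fun c : 𝒳 => τ c = c ∧ (-(eval c.1 (rc P)) / eval c.1 (rc (JR P))).re < 0).card
    + (Finset.univ.filter fun c : 𝒳 => τ c = c ∧ (1 / eval c.1 (rc (JR P))).re < 0).card
    ≤ (Finset.univ.filter fun c : 𝒳 => τ c = c ∧ eval c.1 (rc P) ≠ 0).card := by
    rw [← Finset.card_union_of_disjoint]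
    · apply Finset.card_le_card
      intro c hc
      simp only [Finset.mem_union, Finset.mem_filter, Finset.mem_univ, true_and] at hc ⊢
      rcases hc with ⟨h1, h2⟩ | ⟨h1, h2⟩
      · refine ⟨h1, fun h => ?_⟩
        rw [h] at h2
        simp at h2
      · refine ⟨h1, fun h => ?_⟩
        obtain ⟨x, hx⟩ := hreal c h1
        rw [hx, rc_real] at h h2
        have h3 := psd_jac P hpos x (by exact_mod_cast h)
        rw [← Complex.ofReal_one, ← Complex.ofReal_div, Complex.ofReal_re] at h2
        have : 0 ≤ 1 / eval x (JR P) := div_nonneg zero_le_one h3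
        linarith
    · rw [Finset.disjoint_left]
      intro c hc hc'
      simp only [Finset.mem_filter, Finset.mem_univ, true_and] at hc hc'
      obtain ⟨x, hx⟩ := hreal c hc.1
      have h1 := hc.2
      have h2 := hc'.2
      rw [hx, rc_real] at h1 h2
      rw [rc_real, ← Complex.ofReal_neg, ← Complex.ofReal_div, Complex.ofReal_re] at h1
      rw [← Complex.ofReal_one, ← Complex.ofReal_div, Complex.ofReal_re] at h2
      have h3 : -eval x P / eval x (JR P) = -eval x P * (1 / eval x (JR P)) := by ring
      rw [h3] at h1
      nlinarith [hpos x]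
  have g2 : T.card ≤ (Finset.univ.filter fun c : 𝒳 => τ c = c ∧ eval c.1 (rc P) = 0).card := by
    rw [← Finset.card_map (Function.Embedding.subtype _)]
    refine Finset.card_le_card_of_injOn (fun x i => (x i : ℂ)) ?_ ?_
    · intro x hx
      obtain ⟨x0, xP⟩ := hT x hx
      have e1 := psd_grad P hpos x xP 1
      have e2 := psd_grad P hpos x xP 2
      have hm : (fun i => (x i : ℂ)) ∈ 𝒳 := (h𝒳 _).2 ⟨by simp [x0], by rw [rc_real, e1]; simp, by rw [rc_real, e2]; simp⟩
      refine Finset.mem_coe.mpr (Finset.mem_map.mpr ⟨⟨_, hm⟩, ?_, rfl⟩)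
      simp only [Finset.mem_filter, Finset.mem_univ, true_and]
      refine ⟨Subtype.ext ?_, by rw [rc_real, xP]; simp⟩
      rw [hτ]
      ext i
      simp [cjv]
    · intro x _ y _ hxy
      ext i
      exact Complex.ofReal_injective (congrFun hxy i)
  have q1 := choose_two_eq j
  have q2 := choose_two_eq (2 * j + 1)
  rw [show 2 * j + 1 + 2 = 2 * j + 3 by ring] at q2
  simp only [ne_eq] at c2 i1 g1
  nlinarith

end

section

abbrev R3 := MvPolynomial (Fin 3) ℂ

lemma exists_rel (R0 : R3) (g : Fin 3 → R3) :
    ∃ q : Polynomial R3, q ≠ 0 ∧ Polynomial.eval₂ (aeval g : R3 →ₐ[ℂ] R3).toRingHom R0 q = 0 := by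
  let v : Option (Fin 3) → R3 := fun o => o.elim R0 g
  have hdep : ¬ AlgebraicIndependent ℂ v := by
    intro h
    have h1 := h.lift_cardinalMk_le_trdeg
    rw [MvPolynomial.trdeg_of_isDomain] at h1
    simp at h1
    norm_num at h1
  rw [algebraicIndependent_iff] at hdep
  push Not at hdep
  obtain ⟨p, hp, hp0⟩ := hdep
  refine ⟨optionEquivLeft ℂ (Fin 3) p, by simpa using hp0, ?_⟩
  have : (Polynomial.aevalTower (aeval g : R3 →ₐ[ℂ] R3) R0).comp (optionEquivLeft ℂ (Fin 3)).toAlgHom = aeval v := by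
    apply MvPolynomial.algHom_ext
    intro i
    cases i <;> simp [v]
  have h2 := DFunLike.congr_fun this p
  rw [hp] at h2
  exact h2

lemma eval_aeval_R3 (x : Fin 3 → ℂ) (g : Fin 3 → R3) (w : R3) : eval x (aeval g w) = eval (fun i => eval x (g i)) w := by
  induction w using MvPolynomial.induction_on with
  | C a => simp
  | add p q hp hq => simp only [map_add, hp, hq]
  | mul_X p j hp => simp only [map_mul, hp, aeval_X, eval_X]

lemma dep_w (R0 : R3) (hR0 : R0 ≠ 0) (g : Fin 3 → R3) :
    ∃ w : R3, w ≠ 0 ∧ ∀ x, eval x R0 = 0 → eval (fun i => eval x (g i)) w = 0 := by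
  obtain ⟨q, hq, hq0⟩ := exists_rel R0 g
  obtain ⟨q', h1, h2⟩ := q.exists_eq_pow_rootMultiplicity_mul_and_not_dvd hq 0
  rw [h1, Polynomial.eval₂_mul, Polynomial.eval₂_pow] at hq0
  simp only [map_zero, sub_zero, Polynomial.eval₂_X] at hq0 h2
  have hq' := (mul_eq_zero.mp hq0).resolve_left (pow_ne_zero _ hR0)
  refine ⟨q'.coeff 0, fun h => h2 (Polynomial.X_dvd_iff.mpr h), fun x hx => ?_⟩
  have h3 := congrArg (eval x) hq'
  rw [← Polynomial.X_mul_divX_add q', Polynomial.eval₂_add, Polynomial.eval₂_mul, Polynomial.eval₂_X, Polynomial.eval₂_C,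
    map_add, map_mul, hx, zero_mul, zero_add, map_zero] at h3
  rw [← eval_aeval_R3]
  exact h3

lemma hess_w (g : Fin 3 → R3) :
    ∃ w : R3, w ≠ 0 ∧ ∀ x, eval x (Matrix.of fun i j => pderiv j (g i)).det = 0 → eval (fun i => eval x (g i)) w = 0 := by
  by_cases hdet : (Matrix.of fun i j => pderiv j (g i)).det = 0
  swap
  · exact dep_w _ hdet g
  obtain ⟨v, hv0, hv⟩ := Matrix.exists_mulVec_eq_zero_iff.mpr hdet
  obtain ⟨i, hi⟩ : ∃ i, v i ≠ 0 := by
    by_contra h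
    push Not at h
    exact hv0 (funext h)
  let D : Derivation ℂ R3 R3 := ∑ l, v l • pderiv l
  have hD : ∀ p, D p = ∑ l, v l * pderiv l p := by
    intro p
    simp only [D, Fin.sum_univ_three, Derivation.add_apply, Derivation.smul_apply, smul_eq_mul]
  have hDg : ∀ j, D (g j) = 0 := by
    intro j
    have := congrFun hv j
    rw [hD]
    refine Eq.trans ?_ this
    simp only [Matrix.mulVec, dotProduct, Matrix.of_apply]
    exact Finset.sum_congr rfl fun _ _ => mul_comm _ _
  have hDX : D (X i) = v i := by
    rw [hD, Finset.sum_eq_single i]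
    · simp
    · intro b _ hb
      rw [pderiv_X_of_ne hb.symm, mul_zero]
    · simp
  have hDc : ∀ w : R3, D (aeval g w) = 0 := by
    intro w
    rw [deriv_aeval]
    simp [hDg]
  -- minimal relation
  have hrel := exists_rel (X i) g
  let S := {n | ∃ q : Polynomial R3, q.natDegree = n ∧ q ≠ 0 ∧ Polynomial.eval₂ (aeval g : R3 →ₐ[ℂ] R3).toRingHom (X i) q = 0}
  have hS : S.Nonempty := by
    obtain ⟨q, h1, h2⟩ := hrel
    exact ⟨_, q, rfl, h1, h2⟩
  obtain ⟨q, hqn, hq0, hq⟩ := Nat.sInf_mem hS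
  have hmin : ∀ q' : Polynomial R3, q' ≠ 0 → Polynomial.eval₂ (aeval g : R3 →ₐ[ℂ] R3).toRingHom (X i) q' = 0 → q.natDegree ≤ q'.natDegree := by
    intro q' h1 h2
    rw [hqn]
    exact Nat.sInf_le ⟨q', rfl, h1, h2⟩
  have hder : ∀ p : Polynomial R3, D (Polynomial.eval₂ (aeval g : R3 →ₐ[ℂ] R3).toRingHom (X i) p) =
     Polynomial.eval₂ (aeval g : R3 →ₐ[ℂ] R3).toRingHom (X i) p.derivative * v i := by
    intro p
    induction p using Polynomial.induction_on' with
    | add p q hp hq => rw [Polynomial.eval₂_add, map_add, hp, hq, map_add, Polynomial.eval₂_add, add_mul]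
    | monomial n a =>
      have : D ((aeval g : R3 →ₐ[ℂ] R3).toRingHom a) = 0 := hDc a
      rw [Polynomial.eval₂_monomial, Derivation.leibniz, this, Derivation.leibniz_pow, hDX, Polynomial.derivative_monomial,
        Polynomial.eval₂_monomial]
      simp
      ring
  have h0 : q.derivative = 0 := by
    by_contra hne
    have h1 := hder q
    rw [hq, map_zero] at h1
    have h2 := (mul_eq_zero.mp h1.symm).resolve_right hi
    have h3 := hmin _ hne h2
    have h4 : q.natDegree ≠ 0 := by
      intro h4
      exact hne (Polynomial.derivative_of_natDegree_zero h4)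
    have := Polynomial.natDegree_derivative_lt h4
    omega
  have h5 := Polynomial.derivative_eq_zero.mp h0
  obtain ⟨w, rfl⟩ := Polynomial.natDegree_eq_zero.mp h5
  refine ⟨w, by simpa using hq0, fun x _ => ?_⟩
  rw [Polynomial.eval₂_C] at hq
  rw [← eval_aeval_R3]
  have := congrArg (eval x) hq
  rw [map_zero] at this
  exact this

lemma exists_real_ne (W : R3) (hW : W ≠ 0) : ∃ l : Fin 3 → ℝ, eval (fun i => (l i : ℂ)) W ≠ 0 := by
  by_contra h
  push Not at h
  apply hW
  refine MvPolynomial.funext_set (fun _ => Set.range (fun r : ℝ => (r : ℂ))) (fun _ => Set.infinite_range_of_injective Complex.ofReal_injective) fun x hx => ?_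
  have : ∀ i, ∃ r : ℝ, (r : ℂ) = x i := fun i => hx i trivial
  choose l hl using this
  have h1 := h l
  rw [map_zero, ← h1]
  congr 2
  ext i
  exact (hl i).symm

end

section

lemma rank_le_one_of_ker (H : Matrix (Fin 3) (Fin 3) ℂ) (x u : Fin 3 → ℂ) (hx : H.mulVec x = 0)
    (hu : H.mulVec u = 0) (hi : ∀ s t : ℂ, s • x + t • u = 0 → s = 0 ∧ t = 0) : H.rank ≤ 1 := by
  have h1 := LinearMap.finrank_range_add_finrank_ker H.mulVecLin
  have hxk : x ∈ LinearMap.ker H.mulVecLin := by simpa using hx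
  have huk : u ∈ LinearMap.ker H.mulVecLin := by simpa using hu
  have h2 : LinearIndependent ℂ ![(⟨x, hxk⟩ : LinearMap.ker H.mulVecLin), ⟨u, huk⟩] := by
    rw [LinearIndependent.pair_iff]
    intro s t hst
    apply hi
    have := congrArg Subtype.val hst
    simpa using this
  have h3 := h2.fintype_card_le_finrank
  simp at h3 h1
  unfold Matrix.rank
  omega

lemma lin_alg (H : Matrix (Fin 3) (Fin 3) ℂ) (hs : ∀ i j, H i j = H j i) (x : Fin 3 → ℂ) (a b p : ℂ)
    (hx : x 0 + a * x 1 + b * x 2 = 1)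
    (h0 : H 0 0 * x 0 + H 0 1 * x 1 + H 0 2 * x 2 = p)
    (h1 : H 1 0 * x 0 + H 1 1 * x 1 + H 1 2 * x 2 = p * a)
    (h2 : H 2 0 * x 0 + H 2 1 * x 1 + H 2 2 * x 2 = p * b)
    (hJ : (H 1 1 - a * H 0 1 - a * (H 1 0 - a * H 0 0)) * (H 2 2 - b * H 0 2 - b * (H 2 0 - b * H 0 0))
      - (H 2 1 - b * H 0 1 - a * (H 2 0 - b * H 0 0)) * (H 1 2 - a * H 0 2 - b * (H 1 0 - a * H 0 0)) = 0) :
    H.det = 0 ∧ (p = 0 → H.rank ≤ 1) := by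
  have hs1 := hs 1 0
  have hs2 := hs 2 0
  have hs3 := hs 2 1
  rw [hs1, hs2, hs3] at hJ
  rw [hs1] at h1
  rw [hs2, hs3] at h2
  obtain ⟨c, hc0, hc⟩ := (Matrix.exists_mulVec_eq_zero_iff (M := !![H 1 1 - a * H 0 1 - a * (H 0 1 - a * H 0 0), H 1 2 - a * H 0 2 - b * (H 0 1 - a * H 0 0); H 1 2 - b * H 0 1 - a * (H 0 2 - b * H 0 0), H 2 2 - b * H 0 2 - b * (H 0 2 - b * H 0 0)])).mpr (by
    rw [Matrix.det_fin_two_of]; linear_combination hJ)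
  have hc1 := congrFun hc 0
  have hc2 := congrFun hc 1
  simp [Matrix.mulVec, dotProduct, Fin.sum_univ_two] at hc1 hc2
  have hu0 : ∀ t : ℂ, t * c 0 = 0 → t * c 1 = 0 → t = 0 := by
    intro t h3 h4
    by_contra ht
    apply hc0
    ext i; fin_cases i
    · simpa [ht] using h3
    · simpa [ht] using h4
  set u : Fin 3 → ℂ := ![- a * c 0 - b * c 1, c 0, c 1] with hu
  have ue0 : H 0 0 * u 0 + H 0 1 * u 1 + H 0 2 * u 2 = 0 := by
    simp [hu]
    linear_combination (- a * c 0 - b * c 1) * h0 + c 0 * h1 + c 1 * h2 - x 1 * hc1 - x 2 * hc2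
      - (H 0 0 * (- a * c 0 - b * c 1) + H 0 1 * c 0 + H 0 2 * c 1) * hx
  have ue1 : H 0 1 * u 0 + H 1 1 * u 1 + H 1 2 * u 2 = 0 := by
    simp [hu] at ue0 ⊢
    linear_combination hc1 + a * ue0
  have ue2 : H 0 2 * u 0 + H 1 2 * u 1 + H 2 2 * u 2 = 0 := by
    simp [hu] at ue0 ⊢
    linear_combination hc2 + b * ue0
  have hHu : H.mulVec u = 0 := by
    ext i
    fin_cases i <;> simp only [Matrix.mulVec, dotProduct, Fin.sum_univ_three, Fin.zero_eta, Fin.mk_one, Fin.reduceFinMk, hs1, hs2, hs3] <;> assumption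
  refine ⟨Matrix.exists_mulVec_eq_zero_iff.mp ⟨u, ?_, hHu⟩, ?_⟩
  · intro h
    have e1 := congrFun h 1
    have e2 := congrFun h 2
    simp [hu] at e1 e2
    simpa using hu0 1 (by simpa using e1) (by simpa using e2)
  · rintro rfl
    refine rank_le_one_of_ker H x u ?_ hHu ?_
    · ext i
      fin_cases i <;> simp only [Matrix.mulVec, dotProduct, Fin.sum_univ_three, Fin.zero_eta, Fin.mk_one, Fin.reduceFinMk, hs1, hs2, hs3]
      · exact h0
      · simpa using h1
      · simpa using h2
    · intro s t hst
      have e0 := congrFun hst 0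
      have e1 := congrFun hst 1
      have e2 := congrFun hst 2
      simp [hu] at e0 e1 e2
      have hs0 : s = 0 := by linear_combination e0 + a * e1 + b * e2 - s * hx
      subst hs0
      exact ⟨rfl, hu0 t (by simpa using e1) (by simpa using e2)⟩

noncomputable def sh {K : Type} [Field K] (a b : K) : Fin 3 → MvPolynomial (Fin 3) K :=
  ![X 0 - C a * X 1 - C b * X 2, X 1, X 2]

def Mv {K : Type} [Field K] (a b : K) (y : Fin 3 → K) : Fin 3 → K :=
  ![y 0 - a * y 1 - b * y 2, y 1, y 2]

def Nv {K : Type} [Field K] (a b : K) (y : Fin 3 → K) : Fin 3 → K :=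
  ![y 0 + a * y 1 + b * y 2, y 1, y 2]

lemma Mv_Nv {K : Type} [Field K] (a b : K) (y : Fin 3 → K) : Mv a b (Nv a b y) = y := by
  ext i; fin_cases i <;> simp [Mv, Nv] <;> ring

lemma Nv_Mv {K : Type} [Field K] (a b : K) (y : Fin 3 → K) : Nv a b (Mv a b y) = y := by
  ext i; fin_cases i <;> simp [Mv, Nv] <;> ring

section
variable {K : Type} [Field K] (a b : K)

lemma eval_sh (y : Fin 3 → K) (p : MvPolynomial (Fin 3) K) :
    eval y (aeval (sh a b) p) = eval (Mv a b y) p := by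
  have : (fun i => eval y (sh a b i)) = Mv a b y := by
    ext i; fin_cases i <;> simp [sh, Mv]
  rw [← this, aeval_def, ← eval₂_id, ← eval₂_id]
  induction p using MvPolynomial.induction_on with
  | C a => simp
  | add p q hp hq => simp only [eval₂_add, hp, hq]
  | mul_X p i hp => simp only [eval₂_mul, hp, eval₂_X]; simp

lemma sh_hom {n : ℕ} {p : MvPolynomial (Fin 3) K} (hp : p.IsHomogeneous n) :
    (aeval (sh a b) p).IsHomogeneous n := by
  have := hp.aeval (sh a b) (n := 1) (fun i => ?_)
  · simpa using this
  · fin_cases i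
    · simp only [sh]
      exact ((isHomogeneous_X _ _).sub ((isHomogeneous_X _ _).C_mul a)).sub ((isHomogeneous_X _ _).C_mul b)
    · exact isHomogeneous_X _ _
    · exact isHomogeneous_X _ _

lemma pd0_sh (p : MvPolynomial (Fin 3) K) : pderiv 0 (aeval (sh a b) p) = aeval (sh a b) (pderiv 0 p) := by
  rw [deriv_aeval, Fin.sum_univ_three]
  simp [sh, pderiv_X]

lemma pd1_sh (p : MvPolynomial (Fin 3) K) : pderiv 1 (aeval (sh a b) p) =
    aeval (sh a b) (pderiv 1 p) - C a * aeval (sh a b) (pderiv 0 p) := by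
  rw [deriv_aeval, Fin.sum_univ_three]
  simp [sh, pderiv_X]
  ring

lemma pd2_sh (p : MvPolynomial (Fin 3) K) : pderiv 2 (aeval (sh a b) p) =
    aeval (sh a b) (pderiv 2 p) - C b * aeval (sh a b) (pderiv 0 p) := by
  rw [deriv_aeval, Fin.sum_univ_three]
  simp [sh, pderiv_X]
  ring
end

lemma rc_sh (a b : ℝ) (p : MvPolynomial (Fin 3) ℝ) : rc (aeval (sh a b) p) = aeval (sh (a:ℂ) (b:ℂ)) (rc p) := by
  have : (fun i => rc (sh a b i)) = sh (a:ℂ) (b:ℂ) := by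
    ext1 i; fin_cases i <;> simp [sh]
  rw [← this]
  induction p using MvPolynomial.induction_on with
  | C a => simp
  | add p q hp hq => simp only [map_add, hp, hq]
  | mul_X p i hp => simp only [map_mul, hp, aeval_X, map_X]

end

section

noncomputable def Hs (Q : R3) (x : Fin 3 → ℂ) : Matrix (Fin 3) (Fin 3) ℂ :=
  Matrix.of fun i j : Fin 3 => eval x (pderiv i (pderiv j Q))

lemma euler_eval {n : ℕ} {Q : R3} (hQ : Q.IsHomogeneous n) (x : Fin 3 → ℂ) :
    x 0 * eval x (pderiv 0 Q) + x 1 * eval x (pderiv 1 Q) + x 2 * eval x (pderiv 2 Q) = n * eval x Q := by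
  have := congrArg (eval x) hQ.sum_X_mul_pderiv
  simpa [Fin.sum_univ_three] using this

lemma gp_shear {n : ℕ} {Q : R3} (hn : 1 ≤ n) (hQ : Q.IsHomogeneous (n+1)) (a b : ℂ)
    (h1 : ∀ x, eval x (pderiv 0 Q) ≠ 0 → eval x (pderiv 1 Q) = a * eval x (pderiv 0 Q) →
      eval x (pderiv 2 Q) = b * eval x (pderiv 0 Q) → eval x Q ≠ 0 ∧ (Hs Q x).det ≠ 0)
    (h2 : ∀ x, x ≠ 0 → (∀ i, eval x (pderiv i Q) = 0) → x 0 + a * x 1 + b * x 2 ≠ 0)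
    (h3 : ∀ x, x ≠ 0 → (∀ i, eval x (pderiv i Q) = 0) → (Hs Q x).rank = 2) :
    GP n (pderiv 1 (aeval (sh a b) Q)) (pderiv 2 (aeval (sh a b) Q)) := by
  have hom : ∀ i, (pderiv i Q).IsHomogeneous n := fun i => by simpa using hQ.pderiv (i := i)
  refine ⟨hn, by simpa using (sh_hom a b hQ).pderiv (i := 1), by simpa using (sh_hom a b hQ).pderiv (i := 2), ?_, ?_⟩
  · intro y hy hA hB
    rw [pd1_sh, map_sub, map_mul, eval_C, eval_sh, eval_sh, sub_eq_zero] at hA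
    rw [pd2_sh, map_sub, map_mul, eval_C, eval_sh, eval_sh, sub_eq_zero] at hB
    set x := Mv a b y with hxd
    have hxs : x 0 + a * x 1 + b * x 2 = 0 := by
      rw [hxd]; simp [Mv]; linear_combination hy
    have he := euler_eval hQ x
    rw [hA, hB] at he
    have hQ0 : eval x Q = 0 := by
      have : ((n+1:ℕ):ℂ) * eval x Q = 0 := by rw [← he]; linear_combination eval x (pderiv 0 Q) * hxs
      rcases mul_eq_zero.mp this with h | h
      · exact absurd h (by exact_mod_cast n.succ_ne_zero)
      · exact h
    have hP0 : eval x (pderiv 0 Q) = 0 := by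
      by_contra hne
      exact (h1 x hne hA hB).1 hQ0
    have hx0 : x = 0 := by
      by_contra hx
      refine h2 x hx (fun i => ?_) hxs
      fin_cases i
      · exact hP0
      · simpa [hP0] using hA
      · simpa [hP0] using hB
    rw [← Nv_Mv a b y, ← hxd, hx0]
    ext i; fin_cases i <;> simp [Nv]
  · intro y hy hA hB hJ
    rw [pd1_sh, map_sub, map_mul, eval_C, eval_sh, eval_sh, sub_eq_zero] at hA
    rw [pd2_sh, map_sub, map_mul, eval_C, eval_sh, eval_sh, sub_eq_zero] at hB
    simp only [pd1_sh, pd2_sh, map_sub, map_mul, eval_C, eval_sh, Derivation.leibniz, pderiv_C, smul_eq_mul, mul_zero, add_zero] at hJ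
    set x := Mv a b y with hxd
    have hxs : x 0 + a * x 1 + b * x 2 = 1 := by
      rw [hxd]; simp [Mv]; linear_combination hy
    have e0 := euler_eval (hom 0) x
    have e1 := euler_eval (hom 1) x
    have e2 := euler_eval (hom 2) x
    have hsym : ∀ i j, Hs Q x i j = Hs Q x j i := fun i j => by
      simp only [Hs, Matrix.of_apply]; rw [pderiv_comm']
    have hl := lin_alg (Hs Q x) hsym x a b (n * eval x (pderiv 0 Q)) hxs
      (by rw [hsym 0 1, hsym 0 2]; simp only [Hs, Matrix.of_apply]; linear_combination e0)
      (by rw [hsym 1 0, hsym 1 2]; simp only [Hs, Matrix.of_apply]; linear_combination e1 + n * hA)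
      (by rw [hsym 2 0, hsym 2 1]; simp only [Hs, Matrix.of_apply]; linear_combination e2 + n * hB)
      (by simp only [Hs, Matrix.of_apply]; 
          rw [pderiv_comm' 2 1] at hJ ⊢
          rw [pderiv_comm' 2 0] at hJ ⊢
          rw [pderiv_comm' 1 0] at hJ ⊢
          linear_combination hJ)
    by_cases hP0 : eval x (pderiv 0 Q) = 0
    · have := hl.2 (by rw [hP0, mul_zero])
      have hx0 : x ≠ 0 := by
        intro h; rw [h] at hxs; simp at hxs
      rw [h3 x hx0 (fun i => by
        fin_cases i
        · exact hP0
        · simpa [hP0] using hA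
        · simpa [hP0] using hB)] at this
      omega
    · exact (h1 x hP0 hA hB).2 hl.1

end

section

lemma Hs_smul {n : ℕ} {Q : R3} (hQ : Q.IsHomogeneous (n+1)) (c : ℂ) (x : Fin 3 → ℂ) :
    Hs Q (c • x) = c ^ (n-1) • Hs Q x := by
  ext i j
  have h1 : (pderiv j Q).IsHomogeneous n := by simpa using hQ.pderiv (i := j)
  simp only [Hs, Matrix.of_apply, Matrix.smul_apply, smul_eq_mul]
  exact hom_smul (h1.pderiv (i := i)) c x

lemma generic {n : ℕ} {Q : R3} (hn : 1 ≤ n) (hQ0 : Q ≠ 0) (hQ : Q.IsHomogeneous (n+1)) (S : Finset (Fin 3 → ℂ)) (hS : ∀ z ∈ S, z ≠ 0) :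
    ∃ a b : ℝ, (∀ x, eval x (pderiv 0 Q) ≠ 0 → eval x (pderiv 1 Q) = a * eval x (pderiv 0 Q) →
      eval x (pderiv 2 Q) = b * eval x (pderiv 0 Q) → eval x Q ≠ 0 ∧ (Hs Q x).det ≠ 0) ∧
      ∀ z ∈ S, z 0 + a * z 1 + b * z 2 ≠ 0 := by
  have hom : ∀ i, (pderiv i Q).IsHomogeneous n := fun i => by simpa using hQ.pderiv (i := i)
  obtain ⟨w1, hw1, H1⟩ := dep_w Q hQ0 (fun i => pderiv i Q)
  obtain ⟨w2, hw2, H2⟩ := hess_w (fun i => pderiv i Q)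
  let L : (Fin 3 → ℂ) → R3 := fun z => C (z 0) * X 0 + C (z 1) * X 1 + C (z 2) * X 2
  have hL : ∀ z l, eval l (L z) = z 0 * l 0 + z 1 * l 1 + z 2 * l 2 := fun z l => by simp [L]
  have hL0 : ∀ z ∈ S, L z ≠ 0 := by
    intro z hz h
    apply hS z hz
    ext i
    have := hL z (Pi.single i 1)
    rw [h] at this
    fin_cases i <;> simpa using this.symm
  have hW : X 0 * w1 * w2 * ∏ z ∈ S, L z ≠ 0 :=
    mul_ne_zero (mul_ne_zero (mul_ne_zero (X_ne_zero _) hw1) hw2) (Finset.prod_ne_zero_iff.mpr hL0)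
  obtain ⟨l, hl⟩ := exists_real_ne _ hW
  rw [map_mul, map_mul, map_mul, eval_X, map_prod] at hl
  obtain ⟨hl, hl4⟩ := mul_ne_zero_iff.mp hl
  obtain ⟨hl, hl3⟩ := mul_ne_zero_iff.mp hl
  obtain ⟨hl1, hl2⟩ := mul_ne_zero_iff.mp hl
  rw [Finset.prod_ne_zero_iff] at hl4
  refine ⟨l 1 / l 0, l 2 / l 0, ?_, ?_⟩
  · intro x h0 h1 h2
    obtain ⟨c, hc⟩ := IsAlgClosed.exists_pow_nat_eq ((l 0 : ℂ) / eval x (pderiv 0 Q)) (show 0 < n by omega)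
    have hg : (fun i => eval (c • x) (pderiv i Q)) = fun i => (l i : ℂ) := by
      ext i
      rw [hom_smul (hom i), hc]
      fin_cases i
      · simp; field_simp
      · simp only [Fin.mk_one, h1]; push_cast; field_simp
      · simp only [Fin.reduceFinMk, h2]; push_cast; field_simp
    constructor
    · intro hx
      apply hl2
      rw [← hg]
      exact H1 (c • x) (by rw [hom_smul hQ, hx, mul_zero])
    · intro hx
      apply hl3
      rw [← hg]
      apply H2 (c • x)
      have : (Hs Q (c • x)).det = 0 := by rw [Hs_smul hQ, Matrix.det_smul, hx, mul_zero]
      rw [← this, ← Matrix.det_transpose, RingHom.map_det]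
      rfl
  · intro z hz h
    apply hl4 z hz
    rw [hL]
    push_cast at h
    field_simp at h
    linear_combination h

end

section

noncomputable def ph {K : Type} [Field K] (a b : K) (p : Projectivization K (Fin 3 → K)) : Fin 3 → K :=
  Nv a b ((p.rep 0 + a * p.rep 1 + b * p.rep 2)⁻¹ • p.rep)

lemma ph_inj {K : Type} [Field K] (a b : K) (p q : Projectivization K (Fin 3 → K))
    (hp : p.rep 0 + a * p.rep 1 + b * p.rep 2 ≠ 0) (hq : q.rep 0 + a * q.rep 1 + b * q.rep 2 ≠ 0)
    (h : ph a b p = ph a b q) : p = q := by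
  have h1 := congrArg (Mv a b) h
  unfold ph at h1
  rw [Mv_Nv, Mv_Nv] at h1
  rw [← p.mk_rep, ← q.mk_rep, Projectivization.mk_eq_mk_iff']
  refine ⟨(p.rep 0 + a * p.rep 1 + b * p.rep 2) * (q.rep 0 + a * q.rep 1 + b * q.rep 2)⁻¹, ?_⟩
  rw [mul_smul, ← h1, smul_smul, mul_inv_cancel₀ hp, one_smul]

lemma ph_zero {K : Type} [Field K] (a b : K) (p : Projectivization K (Fin 3 → K))
    (hp : p.rep 0 + a * p.rep 1 + b * p.rep 2 ≠ 0) : ph a b p 0 = 1 := by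
  simp [ph, Nv]
  field_simp

lemma rep_mk {K : Type} [Field K] (x : Fin 3 → K) (hx : x ≠ 0) :
    ∃ c : K, c ≠ 0 ∧ (Projectivization.mk K x hx).rep = c • x := by
  obtain ⟨u, hu⟩ := Projectivization.exists_smul_eq_mk_rep K x hx
  exact ⟨u, u.ne_zero, hu.symm⟩

lemma sing_mk {n : ℕ} {Q : R3} (hQ : Q.IsHomogeneous (n+1)) (x : Fin 3 → ℂ) (hx : x ≠ 0)
    (hg : ∀ i, eval x (pderiv i Q) = 0) : Projectivization.mk ℂ x hx ∈ SingSet Q := by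
  intro i
  obtain ⟨c, hc, h⟩ := rep_mk x hx
  rw [h, hom_smul (hQ.pderiv (i := i)), hg i, mul_zero]

lemma node_vec {n : ℕ} {Q : R3} (hQ : Q.IsHomogeneous (n+1)) (hnodal : ∀ x ∈ SingSet Q, IsNodeAt Q x)
    (x : Fin 3 → ℂ) (hx : x ≠ 0) (hg : ∀ i, eval x (pderiv i Q) = 0) : (Hs Q x).rank = 2 := by
  have h := hnodal _ (sing_mk hQ x hx hg)
  obtain ⟨c, hc, h1⟩ := rep_mk x hx
  have h2 : (Hs Q (Projectivization.mk ℂ x hx).rep).rank = 2 := h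
  rw [h1, Hs_smul hQ] at h2
  rw [← h2]
  have hu : c ^ (n-1) ≠ 0 := pow_ne_zero _ hc
  have : c ^ (n-1) • Hs Q x = (c ^ (n-1) • (1 : Matrix (Fin 3) (Fin 3) ℂ)) * Hs Q x := by
    rw [Matrix.smul_mul, one_mul]
  rw [this, Matrix.rank_mul_eq_right_of_isUnit_det]
  rw [Matrix.det_smul, Matrix.det_one, mul_one]
  exact (pow_ne_zero _ hu).isUnit

lemma real_sing {P : MvPolynomial (Fin 3) ℝ} (hpos : ∀ x, 0 ≤ eval x P) (p) (hp : p ∈ RZ P) :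
    (fun i => (p.rep i : ℂ)) ≠ 0 ∧ ∀ i, eval (fun i => (p.rep i : ℂ)) (pderiv i (rc P)) = 0 := by
  constructor
  · intro h
    apply p.rep_nonzero
    ext i
    have := congrFun h i
    simpa using this
  · intro i
    have : eval p.rep P = 0 := hp
    rw [pderiv_map]
    change eval (fun i => (p.rep i : ℂ)) (rc (pderiv i P)) = 0
    rw [rc_real, psd_grad P hpos _ this i]
    simp

lemma pos_case {j : ℕ} {P : MvPolynomial (Fin 3) ℝ} (hP : P ≠ 0) (hh : P.IsHomogeneous (2*(j+2)))
    (hpos : ∀ x, 0 ≤ eval x P) (hnodal : ∀ x ∈ SingSet (rc P), IsNodeAt (rc P) x)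
    (hfS : (SingSet (rc P)).Finite) (hc : (SingSet (rc P)).ncard = (j+1)*(2*j+3)) (hfin : (RZ P).Finite) :
    (RZ P).ncard ≤ (j+2)^2+1 := by
  classical
  have hQ : (rc P).IsHomogeneous (2*j+3+1) := hh.map (algebraMap ℝ ℂ)
  have hQ0 : rc P ≠ 0 := by
    intro h
    apply hP
    apply map_injective (algebraMap ℝ ℂ) Complex.ofReal_injective
    rw [map_zero]; exact h
  obtain ⟨a, b, h1, h2'⟩ := generic (by omega) hQ0 hQ (hfS.toFinset.image Projectivization.rep) (by
    intro z hz
    obtain ⟨p, _, rfl⟩ := Finset.mem_image.mp hz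
    exact p.rep_nonzero)
  have h2s : ∀ p ∈ SingSet (rc P), p.rep 0 + a * p.rep 1 + b * p.rep 2 ≠ 0 := fun p hp =>
    h2' _ (Finset.mem_image_of_mem _ (hfS.mem_toFinset.mpr hp))
  have h2 : ∀ x : Fin 3 → ℂ, x ≠ 0 → (∀ i, eval x (pderiv i (rc P)) = 0) → x 0 + a * x 1 + b * x 2 ≠ 0 := by
    intro x hx hg h
    apply h2s _ (sing_mk hQ x hx hg)
    obtain ⟨c, hc, h1⟩ := rep_mk x hx
    rw [h1]
    simp only [Pi.smul_apply, smul_eq_mul]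
    linear_combination c * h
  have hgp := gp_shear (by omega) hQ a b h1 h2 (node_vec hQ hnodal)
  have hpd : ∀ i, pderiv i (aeval (sh (a:ℂ) (b:ℂ)) (rc P)) = rc (pderiv i (aeval (sh a b) P)) := by
    intro i
    rw [← rc_sh, pderiv_map]
  rw [hpd, hpd] at hgp
  have hreal : ∀ p ∈ RZ P, p.rep 0 + a * p.rep 1 + b * p.rep 2 ≠ 0 := by
    intro p hp h
    obtain ⟨h3, h4⟩ := real_sing hpos p hp
    apply h2 _ h3 h4
    exact_mod_cast h
  have key := core_pos (P := aeval (sh a b) P) (sh_hom a b hh) (fun x => by rw [eval_sh]; exact hpos _) hgp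
    (hfS.toFinset.image (ph (a:ℂ) (b:ℂ))) ?_ ?_ (hfin.toFinset.image (ph a b)) ?_
  · rw [Finset.card_image_of_injOn, ← Set.ncard_eq_toFinset_card _ hfin] at key
    · exact key
    · intro p hp q hq h
      simp only [Set.Finite.coe_toFinset] at hp hq
      exact ph_inj a b p q (hreal p hp) (hreal q hq) h
  · intro z
    rw [← hpd, ← hpd, rc_sh, pd1_sh, pd2_sh, map_sub, map_sub, map_mul, map_mul, eval_C, eval_C, eval_sh, eval_sh,
      eval_sh, eval_sh, sub_eq_zero, sub_eq_zero, Finset.mem_image]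
    constructor
    · rintro ⟨p, hp, rfl⟩
      rw [hfS.mem_toFinset] at hp
      have hs := h2s p hp
      have hg : ∀ i, eval p.rep (pderiv i (rc P)) = 0 := hp
      have hv : eval p.rep (rc P) = 0 := by
        have := euler_eval hQ p.rep
        rw [hg, hg, hg] at this
        have h3 : ((2*j+3+1:ℕ):ℂ) ≠ 0 := by exact_mod_cast (Nat.succ_ne_zero (2*j+3))
        have h4 : ((2*j+3+1:ℕ):ℂ) * eval p.rep (rc P) = 0 := by rw [← this]; ring
        exact (mul_eq_zero.mp h4).resolve_left h3
      refine ⟨ph_zero _ _ p hs, ?_⟩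
      unfold ph
      rw [Mv_Nv, hom_smul hQ, hv, hom_smul (hQ.pderiv (i := 0)), hom_smul (hQ.pderiv (i := 1)),
        hom_smul (hQ.pderiv (i := 2)), hg, hg, hg]
      simp
    · rintro ⟨hz, hv, hA, hB⟩
      have hN := Nv_Mv (a:ℂ) (b:ℂ) z
      set x := Mv (a:ℂ) (b:ℂ) z with hxd
      have hxs : x 0 + a * x 1 + b * x 2 = 1 := by
        rw [hxd]; simp [Mv]; linear_combination hz
      have hx0 : x ≠ 0 := by
        intro h; rw [h] at hxs; simp at hxs
      have hP0 : eval x (pderiv 0 (rc P)) = 0 := by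
        by_contra hne
        exact (h1 x hne hA hB).1 hv
      rw [hP0, mul_zero] at hA hB
      have hg : ∀ i, eval x (pderiv i (rc P)) = 0 := by
        intro i
        fin_cases i
        · exact hP0
        · exact hA
        · exact hB
      refine ⟨Projectivization.mk ℂ x hx0, hfS.mem_toFinset.mpr (sing_mk hQ x hx0 hg), ?_⟩
      obtain ⟨c, hc, h3⟩ := rep_mk x hx0
      unfold ph
      rw [h3]
      have : (c • x) 0 + a * (c • x) 1 + b * (c • x) 2 = c := by
        simp only [Pi.smul_apply, smul_eq_mul]
        linear_combination c * hxs
      rw [this, smul_smul, inv_mul_cancel₀ hc, one_smul, hN]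
  · rw [Finset.card_image_of_injOn, ← Set.ncard_eq_toFinset_card _ hfS, hc]
    intro p hp q hq h
    simp only [Set.Finite.coe_toFinset] at hp hq
    exact ph_inj _ _ p q (h2s p hp) (h2s q hq) h
  · intro x hx
    obtain ⟨p, hp, rfl⟩ := Finset.mem_image.mp hx
    rw [hfin.mem_toFinset] at hp
    refine ⟨ph_zero _ _ p (hreal p hp), ?_⟩
    have : eval p.rep P = 0 := hp
    unfold ph
    rw [eval_sh, Mv_Nv, hom_smul hh, this, mul_zero]

end

open Matrix in
lemma sign_lemma {k : ℕ} (hk : 1 ≤ k) {P : MvPolynomial (Fin 3) ℝ} (hh : P.IsHomogeneous (2*k)) (hfin : (RZ P).Finite)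
    (a b : Fin 3 → ℝ) (ha : 0 < eval a P) (hb : eval b P < 0) : False := by
  have ha0 : a ≠ 0 := by
    rintro rfl
    have := hom_smul hh 0 (0 : Fin 3 → ℝ)
    rw [zero_smul, zero_pow (by omega), zero_mul] at this
    linarith
  have hli : LinearIndependent ℝ ![a, b] := by
    rw [LinearIndependent.pair_iff' ha0]
    rintro c rfl
    rw [hom_smul hh, pow_mul] at hb
    have : 0 ≤ (c^2)^k * eval a P := by positivity
    linarith
  set c := crossProduct a b with hc
  have hc0 : c ≠ 0 := crossProduct_ne_zero_iff_linearIndependent.mpr hli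
  have hcc : c ⬝ᵥ c ≠ 0 := fun h => hc0 (dotProduct_self_eq_zero.mp h)
  have hac : a ⬝ᵥ c = 0 := dot_self_cross a b
  have hbc : b ⬝ᵥ c = 0 := dot_cross_self a b
  have hind : ∀ x y z : ℝ, x • a + y • b + z • c = 0 → x = 0 ∧ y = 0 ∧ z = 0 := by
    intro x y z h
    have h1 := congrArg (fun v => v ⬝ᵥ c) h
    simp [add_dotProduct, smul_dotProduct, hac, hbc, hcc] at h1
    subst h1
    rw [zero_smul, add_zero] at h
    have := LinearIndependent.pair_iff.mp hli x y h
    exact ⟨this.1, this.2, rfl⟩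
  let f : ℝ → ℝ → Fin 3 → ℝ := fun t s => (1-s) • a + s • b + (s*(1-s)*t) • c
  have hz : ∀ t, ∃ s ∈ Set.Ioo (0:ℝ) 1, eval (f t s) P = 0 := by
    intro t
    have hcont : ContinuousOn (fun s => eval (f t s) P) (Set.Icc 0 1) := by
      apply Continuous.continuousOn
      apply (MvPolynomial.continuous_eval P).comp
      fun_prop
    have := intermediate_value_Ioo' (zero_le_one) hcont
    have h0 : (0:ℝ) ∈ Set.Ioo (eval (f t 1) P) (eval (f t 0) P) := by
      simp [f, ha, hb]
    obtain ⟨s, hs, h⟩ := this h0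
    exact ⟨s, hs, h⟩
  choose s hs hs0 using hz
  have hne : ∀ t, f t (s t) ≠ 0 := by
    intro t h
    have := hind _ _ _ h
    linarith
  have hinj : Function.Injective fun t => Projectivization.mk ℝ (f t (s t)) (hne t) := by
    intro t t' h
    rw [Projectivization.mk_eq_mk_iff'] at h
    obtain ⟨l, hl⟩ := h
    have h1 := hind (l * (1 - s t') - (1 - s t)) (l * s t' - s t) (l * (s t' * (1 - s t') * t') - s t * (1 - s t) * t) (by
      rw [← sub_eq_zero] at hl
      rw [← hl]
      simp only [f]
      module)
    obtain ⟨e1, e2, e3⟩ := h1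
    have hl1 : l = 1 := by linarith
    subst hl1
    have hss : s t' = s t := by linarith
    rw [hss] at e3
    have h2 : s t * (1 - s t) ≠ 0 := mul_ne_zero (hs t).1.ne' (by linarith [(hs t).2])
    have : s t * (1 - s t) * (t' - t) = 0 := by linarith
    have := (mul_eq_zero.mp this).resolve_left h2
    linarith
  apply Set.infinite_range_of_injective hinj
  apply hfin.subset
  rintro _ ⟨t, rfl⟩
  change eval _ P = 0
  obtain ⟨c, hc, h⟩ := rep_mk (f t (s t)) (hne t)
  rw [h, hom_smul hh, hs0, mul_zero]

lemma rank_neg' (M : Matrix (Fin 3) (Fin 3) ℂ) : (-M).rank = M.rank := by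
  have : -M = (-1 : Matrix (Fin 3) (Fin 3) ℂ) * M := by simp
  rw [this, Matrix.rank_mul_eq_right_of_isUnit_det]
  simp [Matrix.det_neg]

lemma sing_neg (Q : R3) : SingSet (-Q) = SingSet Q := by
  ext x; simp [SingSet]

lemma node_neg (Q : R3) (x) : IsNodeAt (-Q) x ↔ IsNodeAt Q x := by
  unfold IsNodeAt
  rw [← rank_neg' (Matrix.of fun i j : Fin 3 => eval x.rep (pderiv i (pderiv j Q)))]
  have : (Matrix.of fun i j : Fin 3 => eval x.rep (pderiv i (pderiv j (-Q)))) = - (Matrix.of fun i j : Fin 3 => eval x.rep (pderiv i (pderiv j Q))) := by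
    ext i j; simp
  rw [this]

lemma rz_neg (P) : RZ (-P) = RZ P := by
  ext x; simp [RZ]

lemma conic_case {P : MvPolynomial (Fin 3) ℝ} (hh : P.IsHomogeneous 2)
    (hpos : ∀ x, 0 ≤ eval x P) (hnodal : ∀ x ∈ SingSet (rc P), IsNodeAt (rc P) x)
    (hc : (SingSet (rc P)).ncard = 0) : RZ P = ∅ := by
  by_contra hne
  obtain ⟨p, hp⟩ := Set.nonempty_iff_ne_empty.mpr hne
  have hQ : (rc P).IsHomogeneous (1+1) := hh.map (algebraMap ℝ ℂ)
  obtain ⟨h1, h2⟩ := real_sing hpos p hp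
  have hS := sing_mk hQ _ h1 h2
  have hHx : ∀ x y : Fin 3 → ℂ, (∀ i, eval x (pderiv i (rc P)) = 0) → (Hs (rc P) y).mulVec x = 0 := by
    intro x y hx
    ext i
    have e := euler_eval (hQ.pderiv (i := i)) x
    rw [hx i, mul_zero] at e
    have hcst : ∀ j, eval y (pderiv i (pderiv j (rc P))) = eval x (pderiv j (pderiv i (rc P))) := by
      intro j
      have h0 : (pderiv j (pderiv i (rc P))).IsHomogeneous 0 := (hQ.pderiv (i := i)).pderiv (i := j)
      rw [pderiv_comm' i j]
      have h3 := hom_smul h0 0 x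
      have h4 := hom_smul h0 0 y
      rw [zero_smul, pow_zero, one_mul] at h3 h4
      rw [← h3, ← h4]
    simp only [Matrix.mulVec, dotProduct, Fin.sum_univ_three, Hs, Matrix.of_apply, hcst, Pi.zero_apply]
    linear_combination e
  have hsub : (SingSet (rc P)).Finite := by
    apply Set.Finite.subset (Set.finite_singleton (Projectivization.mk ℂ _ h1))
    intro q hq
    by_contra hq1
    have hrk := node_vec hQ hnodal _ h1 h2
    have := rank_le_one_of_ker (Hs (rc P) (fun i => (p.rep i : ℂ))) (fun i => (p.rep i : ℂ)) q.rep (hHx _ _ h2) (hHx _ _ hq) (by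
      intro s t hst
      have ht : t = 0 := by
        by_contra ht
        apply hq1
        rw [Set.mem_singleton_iff, ← q.mk_rep, Projectivization.mk_eq_mk_iff']
        refine ⟨- t⁻¹ * s, ?_⟩
        rw [mul_smul, eq_neg_of_add_eq_zero_left hst, smul_neg, neg_smul, neg_neg, smul_smul, inv_mul_cancel₀ ht, one_smul]
      subst ht
      rw [zero_smul, add_zero] at hst
      exact ⟨(smul_eq_zero.mp hst).resolve_right h1, rfl⟩)
    omega
  rw [Set.ncard_eq_zero hsub] at hc
  rw [hc] at hS
  exact hS

lemma pos_all (k : ℕ) (hk : 1 ≤ k) (P : MvPolynomial (Fin 3) ℝ) (hP : P ≠ 0)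
    (hhom : P.IsHomogeneous (2 * k)) (hpos : ∀ x, 0 ≤ eval x P)
    (hnodal : ∀ x ∈ SingSet (rc P), IsNodeAt (rc P) x)
    (hδ : (SingSet (rc P)).ncard = (k - 1) * (2 * k - 1))
    (hfin : (RZ P).Finite) : (RZ P).ncard ≤ k ^ 2 + 1 := by
  rcases Nat.lt_or_ge k 2 with h | h
  · have : k = 1 := by omega
    subst this
    rw [conic_case hhom hpos hnodal (by simpa using hδ)]
    simp
  · obtain ⟨j, rfl⟩ : ∃ j, k = j + 2 := ⟨k - 2, by omega⟩
    have e : (j + 2 - 1) * (2 * (j + 2) - 1) = (j+1)*(2*j+3) := by congr 1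
    rw [e] at hδ
    refine pos_case hP hhom hpos hnodal (Set.finite_of_ncard_ne_zero ?_) hδ hfin
    rw [hδ]; positivity

theorem stmt_2 (k : ℕ) (hk : 1 ≤ k) (P : MvPolynomial (Fin 3) ℝ) (hP : P ≠ 0)
    (hhom : P.IsHomogeneous (2 * k))
    (hsf : Squarefree (MvPolynomial.map (algebraMap ℝ ℂ) P))
    (hnodal : ∀ x ∈ SingSet (MvPolynomial.map (algebraMap ℝ ℂ) P),
      IsNodeAt (MvPolynomial.map (algebraMap ℝ ℂ) P) x)
    (hδ : (SingSet (MvPolynomial.map (algebraMap ℝ ℂ) P)).ncard = (k - 1) * (2 * k - 1))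
    (hfin : (RZ P).Finite) :
    (RZ P).ncard ≤ k ^ 2 + 1 := by
  by_cases hpos : ∀ x, 0 ≤ eval x P
  · exact pos_all k hk P hP hhom hpos hnodal hδ hfin
  · push Not at hpos
    obtain ⟨b, hb⟩ := hpos
    have hpos' : ∀ x, 0 ≤ eval x (-P) := by
      intro x
      rw [map_neg]
      by_contra h
      exact sign_lemma hk hhom hfin x b (by linarith) hb
    have hm : rc (-P) = - rc P := map_neg _ _
    rw [← rz_neg]
    apply pos_all k hk (-P) (neg_ne_zero.mpr hP) hhom.neg hpos'
    · rw [hm, sing_neg]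
      intro x hx
      rw [node_neg]
      exact hnodal x hx
    · rw [hm, sing_neg]; exact hδ
    · rw [rz_neg]; exact hfin
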